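/- arXiv:1507.03207 — 2 statements merged into one kernel-verified Lean document; each statement's English description precedes it below -/
import Mathlib

section
/- Fix γ ≥ 1 and let ρ ∈ C([0,T];P(ℝ^{2d})) satisfy, in duality with C_b²(ℝ^{2d}) and pointwise a.e. in t ∈ [0,T], the perturbed Vlasov–Fokker–Planck equation ∂_t ρ_t = (L_{ρ_t})^* ρ_t − γ div_p(ρ_t h_t) for some measurable vector field h with ∫_0^T ∫_{ℝ^{2d}} |h_t|² dρ_t dt ≤ 2C₀, and assume sup_{t∈[0,T]} ∫_{ℝ^{2d}} (1+V(q)) dρ_t ≤ C₁. Then there is a constant C₂, depending only on C₀, C₁, T, ‖∇ψ‖_∞ and the constant in the bound |∇V|² ≤ C(1+V), but independent of γ, such that for all φ ∈ C_c²(ℝ^d), all t ∈ [0,T] and all τ > 0 with t+τ ≤ T: | ∫_{ℝ^d} φ d(ξ^γ_#ρ_{t+τ}) − ∫_{ℝ^d} φ d(ξ^γ_#ρ_t) | ≤ C₂ ‖∇φ‖_∞ √τ, where ξ^γ(q,p) := q + p/γ. In particular the curves t ↦ ξ^γ_#ρ_t are uniformly 1/2-Hölder continuous with respect to the L¹-Wasserstein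 distance. -/
open MeasureTheory Real Filter Topology Set
open scoped ENNReal NNReal

noncomputable section

/-- Phase space ℝ^{2d} = ℝ^d_q × ℝ^d_p. -/
abbrev Phase (d : ℕ) := (Fin d → ℝ) × (Fin d → ℝ)

/-- The unit direction in the `p_i` coordinate. -/
def dirP {d : ℕ} (i : Fin d) : Phase d := (0, Pi.single i 1)

/-- The unit direction in the `q_i` coordinate. -/
def dirQ {d : ℕ} (i : Fin d) : Phase d := (Pi.single i 1, 0)

/-- Partial derivative in the `p_i` variable. -/
def pdP {d : ℕ} (φ : Phase d → ℝ) (x : Phase d) (i : Fin d) : ℝ :=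
  fderiv ℝ φ x (dirP i)

/-- The Laplacian in the `p` variables. -/
def laplP {d : ℕ} (φ : Phase d → ℝ) (x : Phase d) : ℝ :=
  ∑ i, fderiv ℝ (fun y => pdP φ y i) x (dirP i)

/-- `φ ∈ C_c^∞(ℝ^{2d})`. -/
def IsTestFn {d : ℕ} (φ : Phase d → ℝ) : Prop :=
  ContDiff ℝ (⊤ : ℕ∞) φ ∧ HasCompactSupport φ

/-- The integrand of the duality formula for the relative Fisher information. -/
def fisherIntegrand {d : ℕ} (m : ℝ) (φ : Phase d → ℝ) (x : Phase d) : ℝ :=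
  laplP φ x - (1 / m) * ∑ i, x.2 i * pdP φ x i - (1 / 2) * ∑ i, (pdP φ x i) ^ 2

/-- The relative Fisher information (w.r.t. the `p`-variable). -/
def relFisher {d : ℕ} (m : ℝ) (ν : Measure (Phase d)) : ℝ≥0∞ :=
  ⨆ φ : {φ : Phase d → ℝ // IsTestFn φ},
    ENNReal.ofReal (2 * ∫ x, fisherIntegrand m φ.1 x ∂ν)

/-- Time derivative of a function on `ℝ × ℝ^{2d}`. -/
def tder {d : ℕ} (f : ℝ × Phase d → ℝ) (z : ℝ × Phase d) : ℝ :=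
  fderiv ℝ f z (1, 0)

/-- Partial derivative in `q_i` of a function on `ℝ × ℝ^{2d}`. -/
def qderT {d : ℕ} (f : ℝ × Phase d → ℝ) (z : ℝ × Phase d) (i : Fin d) : ℝ :=
  fderiv ℝ f z (0, dirQ i)

/-- Partial derivative in `p_i` of a function on `ℝ × ℝ^{2d}`. -/
def pderT {d : ℕ} (f : ℝ × Phase d → ℝ) (z : ℝ × Phase d) (i : Fin d) : ℝ :=
  fderiv ℝ f z (0, dirP i)

/-- Laplacian in the `p`-variables of a function on `ℝ × ℝ^{2d}`. -/
def laplPT {d : ℕ} (f : ℝ × Phase d → ℝ) (z : ℝ × Phase d) : ℝ :=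
  ∑ i, fderiv ℝ (fun w => pderT f w i) z ((0 : ℝ), dirP i)

/-- `f ∈ C_b^{1,2}(ℝ × ℝ^{2d})`: (jointly) twice continuously differentiable, bounded
together with its first and second derivatives. -/
def IsCb2 {E : Type*} [NormedAddCommGroup E] [NormedSpace ℝ E] (f : E → ℝ) : Prop :=
  ContDiff ℝ 2 f ∧ ∃ M : ℝ, ∀ z, |f z| ≤ M ∧ ‖fderiv ℝ f z‖ ≤ M ∧
    ‖fderiv ℝ (fderiv ℝ f) z‖ ≤ M

/-- The Hamiltonian `H(q,p) = p²/(2m) + V(q)`. -/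
def Hfun {d : ℕ} (m : ℝ) (V : (Fin d → ℝ) → ℝ) (x : Phase d) : ℝ :=
  (∑ i, (x.2 i) ^ 2) / (2 * m) + V x.1

/-- `(∂_i ψ ∗ ν)(q)` for a measure `ν` on phase space (convolution acts on `q` only). -/
def convGradPsi {d : ℕ} (ψ : (Fin d → ℝ) → ℝ) (ν : Measure (Phase d))
    (q : Fin d → ℝ) (i : Fin d) : ℝ :=
  ∫ y, fderiv ℝ ψ (q - y.1) (Pi.single i 1) ∂ν

/-- The generator `L_ν f = γ J∇(H+ψ∗ν)·∇f − γ²(p/m)·∇_p f + γ²Δ_p f`, acting on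
functions of `(t,x) ∈ ℝ × ℝ^{2d}` (derivatives in the spatial directions only). -/
def Lop {d : ℕ} (m γ : ℝ) (V ψ : (Fin d → ℝ) → ℝ) (ν : Measure (Phase d))
    (f : ℝ × Phase d → ℝ) (z : ℝ × Phase d) : ℝ :=
  γ * ((∑ i, (z.2.2 i / m) * qderT f z i)
      - ∑ i, (fderiv ℝ V z.2.1 (Pi.single i 1) + convGradPsi ψ ν z.2.1 i) * pderT f z i)
    - γ ^ 2 * ∑ i, (z.2.2 i / m) * pderT f z i
    + γ ^ 2 * laplPT f z

/-- The large-deviation rate functional `I^γ` of the VFP equation, in duality form. -/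
def RateI {d : ℕ} (m γ T : ℝ) (V ψ : (Fin d → ℝ) → ℝ)
    (ρ : ℝ → ProbabilityMeasure (Phase d)) : ℝ≥0∞ :=
  ⨆ f : {f : ℝ × Phase d → ℝ // IsCb2 f},
    ENNReal.ofReal (
      (∫ x, f.1 (T, x) ∂(ρ T : Measure (Phase d)))
      - (∫ x, f.1 (0, x) ∂(ρ 0 : Measure (Phase d)))
      - (∫ t in Icc (0 : ℝ) T,
          (∫ x, (tder f.1 (t, x) + Lop m γ V ψ (ρ t : Measure (Phase d)) f.1 (t, x))
            ∂(ρ t : Measure (Phase d))))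
      - γ ^ 2 / 2 * ∫ t in Icc (0 : ℝ) T,
          (∫ x, (∑ i, (pderT f.1 (t, x) i) ^ 2) ∂(ρ t : Measure (Phase d))))

/-- Relative entropy in Donsker–Varadhan duality form,
`H(ν|ζ) = sup_{φ ∈ C_c^∞} [∫ φ dν − log ∫ e^φ dζ]`. -/
def relEntDV {d : ℕ} (ν ζ : Measure (Phase d)) : ℝ≥0∞ :=
  ⨆ φ : {φ : Phase d → ℝ // IsTestFn φ},
    ENNReal.ofReal ((∫ x, φ.1 x ∂ν) - Real.log (∫ x, Real.exp (φ.1 x) ∂ζ))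

/-- Normalization constant `Z_H = ∫ e^{−H}`. -/
def gibbsZ (d : ℕ) (m : ℝ) (V : (Fin d → ℝ) → ℝ) : ℝ :=
  ∫ x : Phase d, Real.exp (-(Hfun m V x))

/-- The normalized Gibbs measure `Z_H⁻¹ e^{−H} dx`. -/
def gibbs (d : ℕ) (m : ℝ) (V : (Fin d → ℝ) → ℝ) : Measure (Phase d) :=
  (ENNReal.ofReal (gibbsZ d m V))⁻¹ •
    volume.withDensity (fun x => ENNReal.ofReal (Real.exp (-(Hfun m V x))))

/-- The interaction energy `∫ (ψ∗ν) dν`. -/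
def interactionEnergy {d : ℕ} (ψ : (Fin d → ℝ) → ℝ) (ν : Measure (Phase d)) : ℝ :=
  ∫ x, (∫ y, ψ (x.1 - y.1) ∂ν) ∂ν

/-- The free energy `F(ν) = H(ν | Z_H⁻¹e^{−H}dx) + ½∫(ψ∗ν)dν`. -/
def FreeEnergy {d : ℕ} (m : ℝ) (V ψ : (Fin d → ℝ) → ℝ) (ν : Measure (Phase d)) : ℝ≥0∞ :=
  relEntDV ν (gibbs d m V) + ENNReal.ofReal ((1 / 2) * interactionEnergy ψ ν)

/-- The standing assumptions (V1)–(V2) on the potentials `V` and `ψ`. -/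
structure PotentialHyp (d : ℕ) (m : ℝ) (V ψ : (Fin d → ℝ) → ℝ) : Prop where
  hd : 1 ≤ d
  hm : 0 < m
  V_smooth : ContDiff ℝ 2 V
  V_nonneg : ∀ q, 0 ≤ V q
  V_hess_bdd : ∃ K, ∀ q, ‖fderiv ℝ (fderiv ℝ V) q‖ ≤ K
  V_grad_growth : ∃ C > 0, ∀ q,
    (∑ i, (fderiv ℝ V q (Pi.single i 1)) ^ 2) ≤ C * (1 + V q)
  V_exp_int : Integrable (fun q => Real.exp (-V q)) (volume : Measure (Fin d → ℝ))
  ψ_smooth : ContDiff ℝ 2 ψ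
  ψ_int : Integrable ψ (volume : Measure (Fin d → ℝ))
  ψ_grad_int : ∀ i, Integrable (fun q => fderiv ℝ ψ q (Pi.single i 1))
    (volume : Measure (Fin d → ℝ))
  ψ_symm : ∀ q, ψ (-q) = ψ q
  ψ_deriv_bdd : ∃ K, ∀ q, ‖fderiv ℝ ψ q‖ ≤ K ∧ ‖fderiv ℝ (fderiv ℝ ψ) q‖ ≤ K
  ψ_conv_nonneg : ∀ ν : ProbabilityMeasure (Fin d → ℝ),
    0 ≤ ∫ q, (∫ q', ψ (q - q') ∂(ν : Measure (Fin d → ℝ))) ∂(ν : Measure (Fin d → ℝ))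

/-- Partial derivative in the `q_i` variable. -/
def pdQ {d : ℕ} (φ : Phase d → ℝ) (x : Phase d) (i : Fin d) : ℝ :=
  fderiv ℝ φ x (dirQ i)

/-- The coarse-graining map `ξ^γ(q,p) = q + p/γ`. -/
def xiGamma {d : ℕ} (γ : ℝ) (x : Phase d) : Fin d → ℝ :=
  fun i => x.1 i + x.2 i / γ

/-- The integrand of the weak formulation of the perturbed VFP equation
`∂_t ρ = (L_ρ)^*ρ − γ div_p(ρ h)`, tested against `f ∈ C_b²(ℝ^{2d})`:
`γ(p/m)·∇_q f − γ∇V·∇_p f − γ(∇ψ∗ρ)·∇_p f − γ²(p/m)·∇_p f + γ²Δ_p f + γ∇_p f·h`. -/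
def VFPweakIntegrand {d : ℕ} (m γ : ℝ) (V ψ : (Fin d → ℝ) → ℝ)
    (ν : Measure (Phase d)) (h : Phase d → Fin d → ℝ)
    (f : Phase d → ℝ) (x : Phase d) : ℝ :=
  γ * (∑ i, (x.2 i / m) * pdQ f x i)
    - γ * (∑ i, fderiv ℝ V x.1 (Pi.single i 1) * pdP f x i)
    - γ * (∑ i, convGradPsi ψ ν x.1 i * pdP f x i)
    - γ ^ 2 * (∑ i, (x.2 i / m) * pdP f x i)
    + γ ^ 2 * laplP f x
    + γ * (∑ i, pdP f x i * h x i)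

/-- The sup norm of the Euclidean gradient of `φ : ℝ^d → ℝ`. -/
def gradSupNormQ {d : ℕ} (φ : (Fin d → ℝ) → ℝ) : ℝ :=
  ⨆ q : Fin d → ℝ, Real.sqrt (∑ i, (fderiv ℝ φ q (Pi.single i 1)) ^ 2)

lemma nonneg_of_grad_bound {d : ℕ} (hd : 1 ≤ d) {u : (Fin d → ℝ) → ℝ} {G : ℝ}
    (hG : ∀ q v, |fderiv ℝ u q v| ≤ G * √(∑ i, v i ^ 2)) : 0 ≤ G := by
  have h := (abs_nonneg _).trans (hG 0 (Pi.single ⟨0, hd⟩ 1))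
  have hs : ∑ i, (Pi.single (⟨0, hd⟩ : Fin d) (1 : ℝ) : Fin d → ℝ) i ^ 2 = 1 := by
    rw [Finset.sum_eq_single ⟨0, hd⟩] <;> simp +contextual
  rwa [hs, Real.sqrt_one, mul_one] at h

lemma sqrt_sum_sq_single {d : ℕ} (i : Fin d) :
    √(∑ j, (Pi.single i (1 : ℝ) : Fin d → ℝ) j ^ 2) = 1 := by
  rw [Finset.sum_eq_single i] <;> simp +contextual

lemma sq_le_sq_of_abs_le {a b : ℝ} (h : |a| ≤ b) : a ^ 2 ≤ b ^ 2 :=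
  sq_le_sq' (abs_le.1 h).1 (abs_le.1 h).2

lemma sqrt_sum_sq_le {d : ℕ} (v : Fin d → ℝ) : √(∑ i, v i ^ 2) ≤ √d * ‖v‖ := by
  rw [← Real.sqrt_sq (norm_nonneg v), ← Real.sqrt_mul (by positivity)]
  apply Real.sqrt_le_sqrt
  calc ∑ i, v i ^ 2 ≤ ∑ _i : Fin d, ‖v‖ ^ 2 := by
        exact Finset.sum_le_sum fun i _ => sq_le_sq_of_abs_le (norm_le_pi_norm v i)
    _ = d * ‖v‖ ^ 2 := by simp

lemma fderiv_apply_eq_sum {d : ℕ} (L : (Fin d → ℝ) →L[ℝ] ℝ) (v : Fin d → ℝ) :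
    L v = ∑ i, L (Pi.single i 1) * v i := by
  conv_lhs => rw [pi_eq_sum_univ' v, map_sum]
  refine Finset.sum_congr rfl fun i _ => ?_
  rw [map_smul, smul_eq_mul, mul_comm]

lemma abs_fderiv_le_gradSupNormQ {d : ℕ} {φ : (Fin d → ℝ) → ℝ} (hφ : ContDiff ℝ 2 φ)
    (hc : HasCompactSupport φ) (q v : Fin d → ℝ) :
    |fderiv ℝ φ q v| ≤ gradSupNormQ φ * √(∑ i, v i ^ 2) := by
  have hcont : Continuous (fderiv ℝ φ) := hφ.continuous_fderiv (by norm_num)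
  obtain ⟨M, hM⟩ := (hc.fderiv ℝ).exists_bound_of_continuous hcont
  have hbdd : BddAbove (range fun q : Fin d → ℝ =>
      √(∑ i, (fderiv ℝ φ q (Pi.single i 1)) ^ 2)) := by
    refine ⟨√(∑ _i : Fin d, M ^ 2), ?_⟩
    rintro _ ⟨q, rfl⟩
    apply Real.sqrt_le_sqrt
    refine Finset.sum_le_sum fun i _ => sq_le_sq_of_abs_le ?_
    have := (fderiv ℝ φ q).le_opNorm (Pi.single i 1)
    rw [Pi.norm_single, norm_one, mul_one] at this
    exact this.trans (hM q)
  have hle := le_ciSup hbdd q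
  have key : ∀ w : Fin d → ℝ, fderiv ℝ φ q w ≤ gradSupNormQ φ * √(∑ i, w i ^ 2) := fun w => by
    rw [fderiv_apply_eq_sum]
    exact (Real.sum_mul_le_sqrt_mul_sqrt _ _ _).trans
      (mul_le_mul_of_nonneg_right hle (Real.sqrt_nonneg _))
  rw [abs_le']
  refine ⟨key v, ?_⟩
  simpa using key (-v)

/-- Mollification at unit scale. -/
lemma exists_unit_mollification (d : ℕ) (hd : 1 ≤ d) : ∃ c : ℝ, 0 ≤ c ∧
    ∀ (u : (Fin d → ℝ) → ℝ) (G : ℝ), ContDiff ℝ 2 u → HasCompactSupport u →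
      (∀ q v, |fderiv ℝ u q v| ≤ G * √(∑ i, v i ^ 2)) →
      ∃ U : (Fin d → ℝ) → ℝ, ContDiff ℝ 2 U ∧ HasCompactSupport U ∧
        (∀ q v, |fderiv ℝ U q v| ≤ G * √(∑ i, v i ^ 2)) ∧
        (∀ q, |U q - u q| ≤ c * G) ∧
        ∀ q i, |fderiv ℝ (fun y => fderiv ℝ U y (Pi.single i 1)) q (Pi.single i 1)|
          ≤ c * G := by
  let b : ContDiffBump (0 : Fin d → ℝ) := ⟨1, 2, one_pos, one_lt_two⟩
  let η : (Fin d → ℝ) → ℝ := b.normed volume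
  have hη : ContDiff ℝ 1 η := b.contDiff_normed
  have hηc : HasCompactSupport η := b.hasCompactSupport_normed
  have hηint : ∫ x, η x = 1 := b.integral_normed
  have hηi : Integrable η := hη.continuous.integrable_of_hasCompactSupport hηc
  have hη0 : ∀ x, 0 ≤ η x := fun x => b.nonneg_normed x
  have hdηi : Integrable (fun x => ‖fderiv ℝ η x‖) :=
    ((hη.continuous_fderiv one_ne_zero).integrable_of_hasCompactSupport (hηc.fderiv ℝ)).norm
  refine ⟨max (√d * 2) (∫ x, ‖fderiv ℝ η x‖), by positivity, fun u G hu huc hG => ?_⟩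
  have hG0 : 0 ≤ G := nonneg_of_grad_bound hd hG
  have hu1 : ContDiff ℝ 1 u := hu.of_le (by norm_num)
  have hduc : Continuous (fderiv ℝ u) := hu.continuous_fderiv (by norm_num)
  let L := ContinuousLinearMap.lsmul ℝ ℝ (E := ℝ)
  have hfd : ∀ x v, fderiv ℝ (convolution η u L volume) x v
      = convolution η (fun a => fderiv ℝ u a v) L volume x := fun x v => by
    rw [(huc.hasFDerivAt_convolution_right L hηi.locallyIntegrable hu1 x).fderiv,
      convolution_precompR_apply L hηi.locallyIntegrable (huc.fderiv ℝ) hduc]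
  refine ⟨convolution η u L volume, ?_, ?_, ?_, ?_, ?_⟩
  · exact huc.contDiff_convolution_right (n := 2) L hηi.locallyIntegrable hu
  · exact hηc.convolution L huc
  · intro q v
    rw [hfd, convolution_def, ← Real.norm_eq_abs]
    refine (norm_integral_le_of_norm_le (hηi.mul_const (G * √(∑ i, v i ^ 2)))
      (Eventually.of_forall fun t => ?_)).trans_eq ?_
    · simp only [L, ContinuousLinearMap.lsmul_apply, smul_eq_mul, norm_mul, Real.norm_eq_abs,
        abs_of_nonneg (hη0 t)]
      exact mul_le_mul_of_nonneg_left (hG _ _) (hη0 t)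
    · rw [integral_mul_const, hηint, one_mul]
  · intro q
    rw [← Real.dist_eq]
    refine (b.dist_normed_convolution_le (ε := G * (√d * 2))
      hu.continuous.aestronglyMeasurable fun x hx => ?_).trans ?_
    · have hop : ∀ y, ‖fderiv ℝ u y‖ ≤ G * √d := fun y =>
        ContinuousLinearMap.opNorm_le_bound _ (by positivity) fun v => by
          rw [mul_assoc]
          exact (hG y v).trans (mul_le_mul_of_nonneg_left (sqrt_sum_sq_le v) hG0)
      rw [dist_eq_norm]
      refine (convex_univ.norm_image_sub_le_of_norm_fderiv_le
        (fun y _ => hu1.differentiable one_ne_zero y) (fun y _ => hop y)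
        (mem_univ q) (mem_univ x)).trans ?_
      rw [← mul_assoc]
      refine mul_le_mul_of_nonneg_left ?_ (by positivity)
      rw [← dist_eq_norm]
      exact (Metric.mem_ball.1 hx).le
    · rw [mul_comm]
      exact mul_le_mul_of_nonneg_right (le_max_left _ _) hG0
  · intro q i
    have hw : Continuous fun a => fderiv ℝ u a (Pi.single i 1) := by fun_prop
    have hfun : (fun y => fderiv ℝ (convolution η u L volume) y (Pi.single i 1))
        = convolution η (fun a => fderiv ℝ u a (Pi.single i 1)) L volume :=
      funext fun y => hfd y _
    rw [hfun, (hηc.hasFDerivAt_convolution_left L hη hw.locallyIntegrable q).fderiv,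
      ← Real.norm_eq_abs]
    refine (ContinuousLinearMap.le_opNorm _ _).trans ?_
    rw [Pi.norm_single, norm_one, mul_one, convolution_def]
    refine (norm_integral_le_of_norm_le (hdηi.mul_const G)
      (Eventually.of_forall fun t => ?_)).trans ?_
    · refine ContinuousLinearMap.opNorm_le_bound _ (by positivity) fun v => ?_
      rw [ContinuousLinearMap.precompL_apply]
      simp only [L, ContinuousLinearMap.lsmul_apply, smul_eq_mul, norm_mul]
      have h1 := (fderiv ℝ η t).le_opNorm v
      have h2 := hG (q - t) (Pi.single i 1)
      rw [sqrt_sum_sq_single, mul_one, ← Real.norm_eq_abs] at h2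
      calc _ ≤ (‖fderiv ℝ η t‖ * ‖v‖) * G := by gcongr
        _ = _ := by ring
    · rw [integral_mul_const]
      exact mul_le_mul_of_nonneg_right (le_max_right _ _) hG0

/-- Mollification at scale `ε`. -/
lemma exists_mollification (d : ℕ) (hd : 1 ≤ d) : ∃ c : ℝ, 0 ≤ c ∧
    ∀ (u : (Fin d → ℝ) → ℝ) (G ε : ℝ), 0 < ε → ContDiff ℝ 2 u → HasCompactSupport u →
      (∀ q v, |fderiv ℝ u q v| ≤ G * √(∑ i, v i ^ 2)) →
      ∃ U : (Fin d → ℝ) → ℝ, ContDiff ℝ 2 U ∧ HasCompactSupport U ∧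
        (∀ q v, |fderiv ℝ U q v| ≤ G * √(∑ i, v i ^ 2)) ∧
        (∀ q, |U q - u q| ≤ c * G * ε) ∧
        ∀ q i, |fderiv ℝ (fun y => fderiv ℝ U y (Pi.single i 1)) q (Pi.single i 1)|
          ≤ c * G / ε := by
  obtain ⟨c, hc, H⟩ := exists_unit_mollification d hd
  refine ⟨c, hc, fun u G ε hε hu huc hG => ?_⟩
  obtain ⟨U, hU, hUc, hU1, hU2, hU3⟩ := H (fun y => u (ε • y)) (ε * G)
    (hu.comp (contDiff_const_smul ε))
    (huc.comp_homeomorph (Homeomorph.smulOfNeZero ε hε.ne')) (fun q v => by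
      rw [fderiv_comp_smul]
      simp only [_root_.smul_apply, smul_eq_mul, abs_mul, abs_of_pos hε, mul_assoc]
      exact mul_le_mul_of_nonneg_left (hG _ _) hε.le)
  have hε' : ε⁻¹ ≠ 0 := inv_ne_zero hε.ne'
  have hfd : ∀ q v, fderiv ℝ (fun q => U (ε⁻¹ • q)) q v = ε⁻¹ * fderiv ℝ U (ε⁻¹ • q) v :=
    fun q v => by rw [fderiv_comp_smul]; rfl
  refine ⟨fun q => U (ε⁻¹ • q), hU.comp (contDiff_const_smul _),
    hUc.comp_homeomorph (Homeomorph.smulOfNeZero ε⁻¹ hε'), fun q v => ?_, fun q => ?_,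
    fun q i => ?_⟩
  · rw [hfd, abs_mul, abs_of_pos (inv_pos.2 hε), inv_mul_le_iff₀ hε, ← mul_assoc]
    exact hU1 _ _
  · have := hU2 (ε⁻¹ • q)
    rw [smul_inv_smul₀ hε.ne'] at this
    exact this.trans_eq (by ring)
  · have hdU : Differentiable ℝ (fderiv ℝ U) :=
      (hU.fderiv_right (m := 1) (by norm_num)).differentiable one_ne_zero
    have hfun : (fun y => fderiv ℝ (fun q => U (ε⁻¹ • q)) y (Pi.single i 1))
        = fun y => ε⁻¹ • (fun z => fderiv ℝ U z (Pi.single i 1)) (ε⁻¹ • y) :=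
      funext fun y => hfd y _
    rw [hfun, fderiv_fun_const_smul, fderiv_comp_smul (f := fun z => fderiv ℝ U z (Pi.single i 1))]
    · simp only [_root_.smul_apply, smul_eq_mul, abs_mul,
        abs_of_pos (inv_pos.2 hε)]
      calc _ ≤ ε⁻¹ * (ε⁻¹ * (c * (ε * G))) := by gcongr; exact hU3 _ i
        _ = _ := by field_simp
    · have : Differentiable ℝ (fun z => fderiv ℝ U z (Pi.single i 1)) := by fun_prop
      exact (this.comp (differentiable_id.const_smul ε⁻¹)).differentiableAt

/-- The coarse-graining map `ξ^γ` as a continuous linear map. -/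
def xiCLM (d : ℕ) (γ : ℝ) : Phase d →L[ℝ] (Fin d → ℝ) :=
  ContinuousLinearMap.fst ℝ _ _ + γ⁻¹ • ContinuousLinearMap.snd ℝ _ _

lemma xiCLM_apply {d : ℕ} (γ : ℝ) (x : Phase d) : xiCLM d γ x = xiGamma γ x := by
  ext i
  simp [xiCLM, xiGamma, div_eq_inv_mul]

lemma xiCLM_dirQ {d : ℕ} (γ : ℝ) (i : Fin d) : xiCLM d γ (dirQ i) = Pi.single i 1 := by
  simp [xiCLM, dirQ]

lemma xiCLM_dirP {d : ℕ} (γ : ℝ) (i : Fin d) :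
    xiCLM d γ (dirP i) = γ⁻¹ • Pi.single i 1 := by
  simp [xiCLM, dirP]

lemma exists_bound_of_contDiff_one {F E : Type*} [NormedAddCommGroup F] [NormedSpace ℝ F]
    [NormedAddCommGroup E] [NormedSpace ℝ E] {g : F → E} (hg : ContDiff ℝ 1 g)
    (hc : HasCompactSupport g) : ∃ M : ℝ, ∀ x, ‖g x‖ ≤ M ∧ ‖fderiv ℝ g x‖ ≤ M := by
  obtain ⟨M₀, h₀⟩ := hg.continuous.bounded_above_of_compact_support hc
  obtain ⟨M₁, h₁⟩ := (hg.continuous_fderiv one_ne_zero).bounded_above_of_compact_support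
    (hc.fderiv ℝ)
  exact ⟨max M₀ M₁, fun x => ⟨(h₀ x).trans (le_max_left _ _), (h₁ x).trans (le_max_right _ _)⟩⟩

lemma isCb2_of_hasCompactSupport {F : Type*} [NormedAddCommGroup F] [NormedSpace ℝ F]
    {φ : F → ℝ} (hφ : ContDiff ℝ 2 φ) (hc : HasCompactSupport φ) : IsCb2 φ := by
  obtain ⟨M₀, h₀⟩ := exists_bound_of_contDiff_one (hφ.of_le one_le_two) hc
  obtain ⟨M₁, h₁⟩ := exists_bound_of_contDiff_one (hφ.fderiv_right (m := 1) (by norm_num))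
    (hc.fderiv ℝ)
  exact ⟨hφ, max M₀ M₁, fun x => ⟨(h₀ x).1.trans (le_max_left _ _),
    (h₀ x).2.trans (le_max_left _ _), (h₁ x).2.trans (le_max_right _ _)⟩⟩

lemma IsCb2.comp_clm {E F : Type*} [NormedAddCommGroup E] [NormedSpace ℝ E]
    [NormedAddCommGroup F] [NormedSpace ℝ F] {φ : F → ℝ} (h : IsCb2 φ) (A : E →L[ℝ] F) :
    IsCb2 (fun x => φ (A x)) := by
  obtain ⟨hφ, M, hM⟩ := h
  have hφ1 : ContDiff ℝ 1 (fderiv ℝ φ) := hφ.fderiv_right (by norm_num)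
  let P : (F →L[ℝ] ℝ) →L[ℝ] (E →L[ℝ] ℝ) := (ContinuousLinearMap.compL ℝ E F ℝ).flip A
  have hd : fderiv ℝ (fun x => φ (A x)) = fun x => P (fderiv ℝ φ (A x)) := by
    funext x
    have h : HasFDerivAt (fun x => φ (A x)) ((fderiv ℝ φ (A x)).comp A) x :=
      (hφ.differentiable two_ne_zero (A x)).hasFDerivAt.comp x A.hasFDerivAt
    exact h.fderiv
  have hd2 : ∀ x, fderiv ℝ (fderiv ℝ (fun x => φ (A x))) x
      = P.comp ((fderiv ℝ (fderiv ℝ φ) (A x)).comp A) := fun x => by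
    rw [hd]
    have h : HasFDerivAt (fun x => fderiv ℝ φ (A x)) ((fderiv ℝ (fderiv ℝ φ) (A x)).comp A) x :=
      (hφ1.differentiable one_ne_zero (A x)).hasFDerivAt.comp x A.hasFDerivAt
    exact (P.hasFDerivAt.comp x h).fderiv
  refine ⟨hφ.comp A.contDiff, max M (max (M * ‖A‖) (‖P‖ * (M * ‖A‖))), fun x => ⟨?_, ?_, ?_⟩⟩
  · exact (hM _).1.trans (le_max_left _ _)
  · rw [hd]
    refine le_trans ?_ ((le_max_left _ _).trans (le_max_right _ _))
    exact (ContinuousLinearMap.opNorm_comp_le _ _).trans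
      (mul_le_mul_of_nonneg_right (hM _).2.1 (norm_nonneg _))
  · rw [hd2]
    refine le_trans ?_ ((le_max_right _ _).trans (le_max_right _ _))
    refine (ContinuousLinearMap.opNorm_comp_le _ _).trans ?_
    refine mul_le_mul_of_nonneg_left ?_ (norm_nonneg _)
    exact (ContinuousLinearMap.opNorm_comp_le _ _).trans
      (mul_le_mul_of_nonneg_right (hM _).2.2 (norm_nonneg _))

lemma fderiv_comp_xi {d : ℕ} {γ : ℝ} {φ : (Fin d → ℝ) → ℝ} {x : Phase d}
    (hφ : DifferentiableAt ℝ φ (xiGamma γ x)) (v : Phase d) :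
    fderiv ℝ (fun y => φ (xiGamma γ y)) x v = fderiv ℝ φ (xiGamma γ x) (xiCLM d γ v) := by
  simp only [← xiCLM_apply] at hφ ⊢
  have h : HasFDerivAt (fun y => φ (xiCLM d γ y))
      ((fderiv ℝ φ (xiCLM d γ x)).comp (xiCLM d γ)) x :=
    hφ.hasFDerivAt.comp x (xiCLM d γ).hasFDerivAt
  rw [h.fderiv]
  rfl

/-- Tested against `φ ∘ ξ^γ`, the transport and friction terms in `p` cancel and all
remaining prefactors `γ` disappear. -/
lemma VFPweakIntegrand_comp_xi {d : ℕ} {m γ : ℝ} (hγ : γ ≠ 0) (V ψ : (Fin d → ℝ) → ℝ)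
    (ν : Measure (Phase d)) (h : Phase d → Fin d → ℝ) {φ : (Fin d → ℝ) → ℝ}
    (hφ : ContDiff ℝ 2 φ) (x : Phase d) :
    VFPweakIntegrand m γ V ψ ν h (fun y => φ (xiGamma γ y)) x
      = -fderiv ℝ φ (xiGamma γ x) (fun i => fderiv ℝ V x.1 (Pi.single i 1))
        - fderiv ℝ φ (xiGamma γ x) (convGradPsi ψ ν x.1)
        + ∑ i, fderiv ℝ (fun y => fderiv ℝ φ y (Pi.single i 1)) (xiGamma γ x) (Pi.single i 1)
        + fderiv ℝ φ (xiGamma γ x) (h x) := by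
  have hdiff := hφ.differentiable two_ne_zero
  have hdiff2 : Differentiable ℝ (fderiv ℝ φ) :=
    (hφ.fderiv_right (m := 1) (by norm_num)).differentiable one_ne_zero
  have hQ : ∀ y i, pdQ (fun y => φ (xiGamma γ y)) y i
      = fderiv ℝ φ (xiGamma γ y) (Pi.single i 1) := fun y i => by
    rw [pdQ, fderiv_comp_xi (hdiff _), xiCLM_dirQ]
  have hP : ∀ y i, pdP (fun y => φ (xiGamma γ y)) y i
      = γ⁻¹ * fderiv ℝ φ (xiGamma γ y) (Pi.single i 1) := fun y i => by
    rw [pdP, fderiv_comp_xi (hdiff _), xiCLM_dirP, map_smul, smul_eq_mul]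
  have hL : laplP (fun y => φ (xiGamma γ y)) x = γ⁻¹ ^ 2 *
      ∑ i, fderiv ℝ (fun y => fderiv ℝ φ y (Pi.single i 1)) (xiGamma γ x) (Pi.single i 1) := by
    rw [laplP, Finset.mul_sum]
    refine Finset.sum_congr rfl fun i _ => ?_
    have hw : Differentiable ℝ fun z => γ⁻¹ * fderiv ℝ φ z (Pi.single i 1) := by fun_prop
    have hw' : Differentiable ℝ fun z => fderiv ℝ φ z (Pi.single i 1) := by fun_prop
    simp only [hP]
    rw [fderiv_comp_xi (φ := fun z => γ⁻¹ * fderiv ℝ φ z (Pi.single i 1)) (hw _), xiCLM_dirP,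
      map_smul, fderiv_const_mul (hw' _)]
    simp only [_root_.smul_apply, smul_eq_mul]
    ring
  have hsum : ∀ a : Fin d → ℝ, ∑ i, a i * (γ⁻¹ * fderiv ℝ φ (xiGamma γ x) (Pi.single i 1))
      = γ⁻¹ * fderiv ℝ φ (xiGamma γ x) a := fun a => by
    rw [fderiv_apply_eq_sum _ a, Finset.mul_sum]
    exact Finset.sum_congr rfl fun i _ => by ring
  have hsum' : ∀ a : Fin d → ℝ, ∑ i, γ⁻¹ * fderiv ℝ φ (xiGamma γ x) (Pi.single i 1) * a i
      = γ⁻¹ * fderiv ℝ φ (xiGamma γ x) a := fun a => by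
    rw [← hsum]
    exact Finset.sum_congr rfl fun i _ => by ring
  have hsumQ : ∑ i, x.2 i / m * fderiv ℝ φ (xiGamma γ x) (Pi.single i 1)
      = fderiv ℝ φ (xiGamma γ x) (fun i => x.2 i / m) := by
    rw [fderiv_apply_eq_sum]
    exact Finset.sum_congr rfl fun i _ => by ring
  simp only [VFPweakIntegrand, hQ, hP, hL]
  rw [hsumQ, hsum (fun i => fderiv ℝ V x.1 (Pi.single i 1)), hsum (convGradPsi ψ ν x.1),
    hsum (fun i => x.2 i / m), hsum' (h x)]
  field_simp
  ring

lemma abs_convGradPsi_le {d : ℕ} {ψ : (Fin d → ℝ) → ℝ} {K : ℝ} (hK : ∀ q, ‖fderiv ℝ ψ q‖ ≤ K)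
    (ν : Measure (Phase d)) [IsProbabilityMeasure ν] (q : Fin d → ℝ) (i : Fin d) :
    |convGradPsi ψ ν q i| ≤ K := by
  rw [← Real.norm_eq_abs, convGradPsi]
  refine (norm_integral_le_of_norm_le_const (C := K) (Eventually.of_forall fun y => ?_)).trans ?_
  · have := (fderiv ℝ ψ (q - y.1)).le_opNorm (Pi.single i 1)
    rw [Pi.norm_single, norm_one, mul_one] at this
    exact this.trans (hK _)
  · simp

lemma sqrt_le_young {s l : ℝ} (hs : 0 ≤ s) (hl : 0 < l) : √s ≤ (l⁻¹ + l * s) / 2 := by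
  have h := sq_nonneg (l * √s - 1)
  have h2 := Real.sq_sqrt hs
  have h3 : l⁻¹ * (l * √s - 1) ^ 2 = l * s - 2 * √s + l⁻¹ := by
    rw [← h2]
    field_simp
    rw [Real.sqrt_sq (Real.sqrt_nonneg _)]
    ring
  have h4 := mul_nonneg (inv_pos.2 hl).le h
  linarith

lemma abs_VFPweakIntegrand_comp_xi_le {d : ℕ} {m γ C K G D l : ℝ} (hγ : γ ≠ 0) (hG0 : 0 ≤ G)
    (hl : 0 < l) {V ψ : (Fin d → ℝ) → ℝ}
    (hV : ∀ q, ∑ i, (fderiv ℝ V q (Pi.single i 1)) ^ 2 ≤ C * (1 + V q))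
    (hK : ∀ q, ‖fderiv ℝ ψ q‖ ≤ K) (ν : Measure (Phase d)) [IsProbabilityMeasure ν]
    (h : Phase d → Fin d → ℝ) {φ : (Fin d → ℝ) → ℝ} (hφ : ContDiff ℝ 2 φ)
    (hG : ∀ q v, |fderiv ℝ φ q v| ≤ G * √(∑ i, v i ^ 2))
    (hD : ∀ q i, |fderiv ℝ (fun y => fderiv ℝ φ y (Pi.single i 1)) q (Pi.single i 1)| ≤ D)
    (x : Phase d) :
    |VFPweakIntegrand m γ V ψ ν h (fun y => φ (xiGamma γ y)) x|
      ≤ G * C / 2 * (1 + V x.1) + (G * (2 + d * K ^ 2 + l⁻¹) / 2 + d * D)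
        + G * l / 2 * ∑ i, h x i ^ 2 := by
  rw [VFPweakIntegrand_comp_xi hγ V ψ ν h hφ x]
  have key : ∀ (v : Fin d → ℝ) (k s : ℝ), 0 < k → ∑ i, v i ^ 2 ≤ s →
      |fderiv ℝ φ (xiGamma γ x) v| ≤ G * ((k⁻¹ + k * s) / 2) := fun v k s hk hs => by
    refine (hG _ v).trans (mul_le_mul_of_nonneg_left ?_ hG0)
    refine (sqrt_le_young (Finset.sum_nonneg fun i _ => sq_nonneg _) hk).trans ?_
    gcongr
  have h1 := key (fun i => fderiv ℝ V x.1 (Pi.single i 1)) 1 _ one_pos (hV x.1)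
  have h2 := key (convGradPsi ψ ν x.1) 1 (d * K ^ 2) one_pos (by
    calc ∑ i, convGradPsi ψ ν x.1 i ^ 2 ≤ ∑ _i : Fin d, K ^ 2 := by
          exact Finset.sum_le_sum fun i _ => sq_le_sq_of_abs_le (abs_convGradPsi_le hK ν x.1 i)
      _ = d * K ^ 2 := by simp)
  have h3 := key (h x) l _ hl le_rfl
  have h4 : |∑ i, fderiv ℝ (fun y => fderiv ℝ φ y (Pi.single i 1)) (xiGamma γ x)
      (Pi.single i 1)| ≤ d * D := by
    refine (Finset.abs_sum_le_sum_abs _ _).trans ?_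
    refine (Finset.sum_le_sum fun i _ => hD (xiGamma γ x) i).trans_eq (by simp)
  rw [abs_le] at *
  constructor <;> linarith [h1.1, h1.2, h2.1, h2.2, h3.1, h3.2, h4.1, h4.2]

lemma abs_integral_le_of_lintegral_le {α : Type*} [MeasurableSpace α] {μ : Measure α}
    {f : α → ℝ} {B : ℝ} (hB : 0 ≤ B) (h : ∫⁻ a, ‖f a‖ₑ ∂μ ≤ ENNReal.ofReal B) :
    |∫ a, f a ∂μ| ≤ B := by
  have h1 := (enorm_integral_le_lintegral_enorm f).trans h
  rwa [← ofReal_norm, ENNReal.ofReal_le_ofReal_iff hB, Real.norm_eq_abs] at h1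

lemma lintegral_const_mul_add_le {α : Type*} [MeasurableSpace α] {μ : Measure α}
    [IsProbabilityMeasure μ] {f g s : α → ℝ} {A B E C₁ : ℝ} (hA : 0 ≤ A) (hB : 0 ≤ B)
    (hE : 0 ≤ E) (hg : Measurable g) (hg0 : ∀ x, 0 ≤ g x) (hs0 : ∀ x, 0 ≤ s x)
    (hC : ∫⁻ x, ENNReal.ofReal (g x) ∂μ ≤ ENNReal.ofReal C₁) (hC₁ : 0 ≤ C₁)
    (hf : ∀ x, |f x| ≤ A * g x + B + E * s x) :
    ∫⁻ x, ‖f x‖ₑ ∂μ ≤ ENNReal.ofReal (A * C₁ + B)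
      + ENNReal.ofReal E * ∫⁻ x, ENNReal.ofReal (s x) ∂μ := by
  calc ∫⁻ x, ‖f x‖ₑ ∂μ ≤ ∫⁻ x, ((ENNReal.ofReal A * ENNReal.ofReal (g x) + ENNReal.ofReal B)
        + ENNReal.ofReal E * ENNReal.ofReal (s x)) ∂μ := by
        refine lintegral_mono fun x => ?_
        have h1 := hg0 x
        have h2 := hs0 x
        rw [← ofReal_norm, ← ENNReal.ofReal_mul hA, ← ENNReal.ofReal_mul hE,
          ← ENNReal.ofReal_add (by positivity) hB,
          ← ENNReal.ofReal_add (by positivity) (by positivity)]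
        exact ENNReal.ofReal_le_ofReal (hf x)
    _ = (ENNReal.ofReal A * ∫⁻ x, ENNReal.ofReal (g x) ∂μ + ENNReal.ofReal B)
        + ENNReal.ofReal E * ∫⁻ x, ENNReal.ofReal (s x) ∂μ := by
        rw [lintegral_add_left (by fun_prop), lintegral_add_left (by fun_prop),
          lintegral_const_mul' _ _ ENNReal.ofReal_ne_top,
          lintegral_const_mul' _ _ ENNReal.ofReal_ne_top]
        simp
    _ ≤ _ := by
        rw [ENNReal.ofReal_add (by positivity) hB, ENNReal.ofReal_mul hA]
        gcongr

lemma setLIntegral_const_add_mul_le {N F : ℝ → ℝ≥0∞} {T t τ B E C : ℝ} (ht : 0 ≤ t)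
    (hτ : 0 ≤ τ) (htT : t + τ ≤ T) (hB : 0 ≤ B) (hE : 0 ≤ E) (hC : 0 ≤ C)
    (hN : ∫⁻ r in Icc 0 T, N r ≤ ENNReal.ofReal C)
    (hF : ∀ r ∈ Icc t (t + τ), F r ≤ ENNReal.ofReal B + ENNReal.ofReal E * N r) :
    ∫⁻ r in Icc t (t + τ), F r ≤ ENNReal.ofReal (B * τ + E * C) := by
  calc ∫⁻ r in Icc t (t + τ), F r
      ≤ ∫⁻ r in Icc t (t + τ), (ENNReal.ofReal B + ENNReal.ofReal E * N r) :=
        setLIntegral_mono' measurableSet_Icc hF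
    _ = ENNReal.ofReal B * ENNReal.ofReal τ
        + ENNReal.ofReal E * ∫⁻ r in Icc t (t + τ), N r := by
        rw [lintegral_add_left measurable_const, lintegral_const_mul' _ _ ENNReal.ofReal_ne_top]
        simp
    _ ≤ ENNReal.ofReal B * ENNReal.ofReal τ + ENNReal.ofReal E * ENNReal.ofReal C := by
        gcongr
        exact (lintegral_mono_set (Icc_subset_Icc ht htT)).trans hN
    _ = _ := by
        rw [← ENNReal.ofReal_mul hB, ← ENNReal.ofReal_mul hE,
          ← ENNReal.ofReal_add (by positivity) (by positivity)]

lemma abs_integral_sub_integral_le {α : Type*} [MeasurableSpace α] (μ : Measure α)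
    [IsProbabilityMeasure μ] {f g : α → ℝ} {B : ℝ} (hf : Integrable f μ) (hg : Integrable g μ)
    (h : ∀ x, |f x - g x| ≤ B) : |(∫ x, f x ∂μ) - ∫ x, g x ∂μ| ≤ B := by
  rw [← integral_sub hf hg, ← Real.norm_eq_abs]
  refine (norm_integral_le_of_norm_le_const (C := B) (Eventually.of_forall h)).trans_eq ?_
  simp

lemma integrable_comp_xi {d : ℕ} {γ : ℝ} {φ : (Fin d → ℝ) → ℝ} (hφ : ContDiff ℝ 2 φ)
    (hc : HasCompactSupport φ) (μ : Measure (Phase d)) [IsFiniteMeasure μ] :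
    Integrable (fun x => φ (xiGamma γ x)) μ := by
  obtain ⟨M, hM⟩ := hc.exists_bound_of_continuous hφ.continuous
  simp only [← xiCLM_apply]
  exact Integrable.of_bound (hφ.continuous.comp (xiCLM d γ).continuous).aestronglyMeasurable M
    (Eventually.of_forall fun x => hM _)

/-- equicontinuity estimate (2.21) in Theorem 2.4: for curves `ρ`
solving the perturbed VFP equation `∂_t ρ_t = (L_{ρ_t})^*ρ_t − γ div_p(ρ_t h_t)` weakly,
with `∫₀^T∫|h|²dρ dt ≤ 2C₀` and `sup_t ∫(1+V)dρ_t ≤ C₁`, there is `C₂` --- independent of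
`γ ≥ 1` --- such that for all `φ ∈ C_c²(ℝ^d)`, `t` and `τ > 0` with `t+τ ≤ T`:
`|∫φ d(ξ^γ_#ρ_{t+τ}) − ∫φ d(ξ^γ_#ρ_t)| ≤ C₂‖∇φ‖_∞ √τ`. -/
theorem stmt4 {d : ℕ} {m : ℝ} (V ψ : (Fin d → ℝ) → ℝ)
    (hyp : PotentialHyp d m V ψ)
    (T : ℝ) (hT : 0 < T) (C₀ C₁ : ℝ) (hC₀ : 0 ≤ C₀) (hC₁ : 0 ≤ C₁) :
    ∃ C₂ : ℝ, 0 < C₂ ∧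
      ∀ γ : ℝ, 1 ≤ γ →
      ∀ ρ : ℝ → ProbabilityMeasure (Phase d), ContinuousOn ρ (Icc 0 T) →
      ∀ h : ℝ → Phase d → Fin d → ℝ,
        (∀ t, ∀ i, Measurable (fun x => h t x i)) →
        (∫⁻ t in Icc (0 : ℝ) T,
            (∫⁻ x, ENNReal.ofReal (∑ i, (h t x i) ^ 2) ∂(ρ t : Measure (Phase d)))
          ≤ ENNReal.ofReal (2 * C₀)) →
        (∀ t ∈ Icc (0 : ℝ) T,
          ∫⁻ x, ENNReal.ofReal (1 + V x.1) ∂(ρ t : Measure (Phase d))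
            ≤ ENNReal.ofReal C₁) →
        (∀ f : Phase d → ℝ, IsCb2 f →
          ∀ s t : ℝ, 0 ≤ s → s ≤ t → t ≤ T →
            (∫ x, f x ∂(ρ t : Measure (Phase d)))
              - (∫ x, f x ∂(ρ s : Measure (Phase d)))
            = ∫ r in Icc s t,
                (∫ x, VFPweakIntegrand m γ V ψ (ρ r : Measure (Phase d)) (h r) f x
                  ∂(ρ r : Measure (Phase d)))) →
      ∀ φ : (Fin d → ℝ) → ℝ, ContDiff ℝ 2 φ → HasCompactSupport φ →
      ∀ t τ : ℝ, 0 ≤ t → 0 < τ → t + τ ≤ T →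
        |(∫ x, φ (xiGamma γ x) ∂(ρ (t + τ) : Measure (Phase d)))
            - (∫ x, φ (xiGamma γ x) ∂(ρ t : Measure (Phase d)))|
          ≤ C₂ * gradSupNormQ φ * Real.sqrt τ := by
  obtain ⟨C, hC, hV⟩ := hyp.V_grad_growth
  obtain ⟨K, hK⟩ := hyp.ψ_deriv_bdd
  obtain ⟨c, hc, hmoll⟩ := exists_mollification d hyp.hd
  refine ⟨√T * (C * C₁ / 2 + (2 + d * K ^ 2) / 2) + (d * c + 1 / 2 + C₀ + 2 * c),
    by positivity, ?_⟩
  intro γ hγ ρ _ h _ hh hVint hweak φ hφ hφc t τ ht hτ htT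
  have hGφ := abs_fderiv_le_gradSupNormQ hφ hφc
  set G := gradSupNormQ φ
  have hG0 : 0 ≤ G := nonneg_of_grad_bound hyp.hd hGφ
  have hl : 0 < √τ := Real.sqrt_pos.2 hτ
  obtain ⟨U, hU, hUc, hGU, hUφ, hDU⟩ := hmoll φ G (√τ) hl hφ hφc hGφ
  have hγ0 : γ ≠ 0 := (zero_lt_one.trans_le hγ).ne'
  have hcb : IsCb2 (fun x : Phase d => U (xiGamma γ x)) := by
    simp only [← xiCLM_apply]
    exact (isCb2_of_hasCompactSupport hU hUc).comp_clm _
  set B : ℝ := G * (2 + d * K ^ 2 + (√τ)⁻¹) / 2 + d * (c * G / √τ) with hBdef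
  have hB : 0 ≤ B := by positivity
  have hmain : |(∫ x, U (xiGamma γ x) ∂(ρ (t + τ) : Measure (Phase d)))
      - ∫ x, U (xiGamma γ x) ∂(ρ t : Measure (Phase d))|
      ≤ (G * C / 2 * C₁ + B) * τ + G * √τ / 2 * (2 * C₀) := by
    rw [hweak _ hcb t (t + τ) ht (by linarith) htT]
    refine abs_integral_le_of_lintegral_le (by positivity) ?_
    refine setLIntegral_const_add_mul_le ht hτ.le htT (by positivity) (by positivity)
      (by positivity) hh fun r hr => ?_
    refine (enorm_integral_le_lintegral_enorm _).trans ?_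
    refine lintegral_const_mul_add_le (g := fun x => 1 + V x.1) (by positivity) hB
      (by positivity) ?_ (fun x => ?_) (fun x => ?_)
      (hVint r ⟨ht.trans hr.1, hr.2.trans htT⟩) hC₁ fun x => ?_
    · have := hyp.V_smooth.continuous
      fun_prop
    · linarith [hyp.V_nonneg x.1]
    · exact Finset.sum_nonneg fun i _ => sq_nonneg _
    · exact abs_VFPweakIntegrand_comp_xi_le hγ0 hG0 hl hV (fun q => (hK q).1) _ (h r) hU hGU hDU x
  have happrox : ∀ s, |(∫ x, U (xiGamma γ x) ∂(ρ s : Measure (Phase d)))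
      - ∫ x, φ (xiGamma γ x) ∂(ρ s : Measure (Phase d))| ≤ c * G * √τ := fun s =>
    abs_integral_sub_integral_le _ (integrable_comp_xi hU hUc _) (integrable_comp_xi hφ hφc _)
      fun x => hUφ _
  have h1 := happrox t
  have h2 := happrox (t + τ)
  have hττ : √τ * √τ = τ := Real.mul_self_sqrt hτ.le
  have hτT : τ ≤ √T * √τ := by
    exact hττ.symm.trans_le
      (mul_le_mul_of_nonneg_right (Real.sqrt_le_sqrt (by linarith)) hl.le)
  have hrew : (G * C / 2 * C₁ + B) * τ + G * √τ / 2 * (2 * C₀)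
      = G * (C * C₁ / 2 + (2 + d * K ^ 2) / 2) * τ + (d * c + 1 / 2 + C₀) * G * √τ := by
    rw [hBdef]
    have e1 : (√τ)⁻¹ * τ = √τ := by
      rw [inv_mul_eq_iff_eq_mul₀ hl.ne', hττ]
    rw [div_eq_mul_inv (c * G) (√τ)]
    linear_combination (G / 2 + d * c * G) * e1
  have hfin : G * (C * C₁ / 2 + (2 + d * K ^ 2) / 2) * τ
      ≤ G * (C * C₁ / 2 + (2 + d * K ^ 2) / 2) * (√T * √τ) := by
    gcongr
  rw [hrew] at hmain
  rw [abs_le] at *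
  constructor <;> nlinarith [h1.1, h1.2, h2.1, h2.2, hmain.1, hmain.2]

end
end

section
/- Let γ_n → ∞ and ρ^{γ_n} ∈ C([0,T];P(ℝ^{2d})) satisfy I^{γ_n}(ρ^{γ_n}) + F(ρ^{γ_n}_t|_{t=0}) ≤ C for a constant C independent of n. Assume ρ^{γ_n} → ρ in M([0,T]×ℝ^{2d}) with respect to the narrow topology and ξ^{γ_n}_#ρ^{γ_n} → ξ_#ρ in C([0,T];P(ℝ^d)) uniformly in time with respect to the narrow topology, where ξ^γ(q,p) := q + p/γ and ξ(q,p) := q. Then there exists σ ∈ C([0,T];P(ℝ^d)) such that for almost all t ∈ [0,T], ρ_t(dq dp) = Z^{-1} exp(−p²/(2m)) σ_t(dq) dp, where Z = ∫_{ℝ^d} e^{−p²/(2m)} dp; moreover ξ^{γ_n}_#ρ^{γ_n} → σ uniformly in time and narrowly on P(ℝ^d). -/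
open MeasureTheory Real Filter Topology Set
open scoped ENNReal NNReal

noncomputable section

/-- Normalization constant `Z = ∫_{ℝ^d} e^{−p²/(2m)} dp` of the Maxwellian. -/
def maxwellZ (d : ℕ) (m : ℝ) : ℝ :=
  ∫ p : Fin d → ℝ, Real.exp (-(∑ i, (p i) ^ 2) / (2 * m))

/-- The Maxwellian probability distribution `Z⁻¹ e^{−p²/(2m)} dp` on ℝ^d_p. -/
def maxwellian (d : ℕ) (m : ℝ) : Measure (Fin d → ℝ) :=
  volume.withDensity
    (fun p => ENNReal.ofReal ((maxwellZ d m)⁻¹ * Real.exp (-(∑ i, (p i) ^ 2) / (2 * m))))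

/-- The Ornstein–Uhlenbeck operator `Δ_p φ − (p/m)·∇_p φ`. -/
def ouP {d : ℕ} (m : ℝ) (φ : Phase d → ℝ) (x : Phase d) : ℝ :=
  laplP φ x - (1 / m) * ∑ i, x.2 i * pdP φ x i

/-- The part `(p/m)·∇_q φ − ∇V·∇_p φ` of the Hamiltonian transport operator. -/
def transport {d : ℕ} (m : ℝ) (V : (Fin d → ℝ) → ℝ) (φ : Phase d → ℝ) (x : Phase d) : ℝ :=
  (∑ i, (x.2 i / m) * fderiv ℝ φ x (dirQ i)) -
    ∑ i, fderiv ℝ V x.1 (Pi.single i 1) * pdP φ x i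

lemma exists_bound_fderiv_of_hasCompactSupport {E F : Type*} [NormedAddCommGroup E] [NormedSpace ℝ E]
    [NormedAddCommGroup F] [NormedSpace ℝ F] {g : E → F} (h1 : ContDiff ℝ 1 g)
    (hs : HasCompactSupport g) : ∃ C, ∀ z, ‖fderiv ℝ g z‖ ≤ C :=
  (hs.fderiv ℝ).exists_bound_of_continuous (h1.continuous_fderiv (by norm_num))

lemma HasCompactSupport.isCb2 {E : Type*} [NormedAddCommGroup E] [NormedSpace ℝ E] {f : E → ℝ}
    (hf : ContDiff ℝ 2 f) (hs : HasCompactSupport f) : IsCb2 f := by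
  have h1 : ContDiff ℝ 1 (fderiv ℝ f) := hf.fderiv_right (by norm_num)
  obtain ⟨a, ha⟩ := hs.exists_bound_of_continuous hf.continuous
  obtain ⟨b, hb⟩ := exists_bound_fderiv_of_hasCompactSupport (hf.of_le (by norm_num)) hs
  obtain ⟨c, hc⟩ := exists_bound_fderiv_of_hasCompactSupport h1 (hs.fderiv ℝ)
  refine ⟨hf, max a (max b c), fun z => ⟨?_,?_,?_⟩⟩
  · exact (ha z).trans (le_max_left _ _)
  · exact (hb z).trans ((le_max_left _ _).trans (le_max_right _ _))
  · exact (hc z).trans ((le_max_right _ _).trans (le_max_right _ _))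

lemma Continuous.exists_boundedContinuousFunction {X : Type*} [TopologicalSpace X] {f : X → ℝ}
    (hf : Continuous f) {K : ℝ} (hK : ∀ x, |f x| ≤ K) :
    ∃ g : BoundedContinuousFunction X ℝ, ∀ x, g x = f x :=
  ⟨BoundedContinuousFunction.ofNormedAddCommGroup f hf K hK, fun _ => rfl⟩

lemma integrable_of_continuous_of_bound {X : Type*} [TopologicalSpace X] [MeasurableSpace X]
    [OpensMeasurableSpace X] {μ : Measure X} [IsFiniteMeasure μ] {f : X → ℝ}
    (hf : Continuous f) {K : ℝ} (hK : ∀ x, |f x| ≤ K) : Integrable f μ :=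
  Integrable.of_bound hf.measurable.aestronglyMeasurable K (ae_of_all _ fun x => by simpa using hK x)

lemma abs_integral_le_of_bound {X : Type*} [MeasurableSpace X] {μ : Measure X}
    [IsProbabilityMeasure μ] {f : X → ℝ} {K : ℝ} (hK : ∀ x, |f x| ≤ K) : |∫ x, f x ∂μ| ≤ K := by
  simpa using norm_integral_le_of_norm_le_const (μ := μ) (f := f) (C := K)
    (ae_of_all _ fun x => by simpa using hK x)

lemma abs_setIntegral_Icc_le {T K : ℝ} (hT : 0 < T) {f : ℝ → ℝ} (hK : ∀ t, |f t| ≤ K) :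
    |∫ t in Icc (0 : ℝ) T, f t| ≤ K * T := by
  have := norm_setIntegral_le_of_norm_le_const (μ := volume) (s := Icc (0 : ℝ) T) (f := f) (C := K)
    (by simp) (fun t _ => hK t)
  simpa [measureReal_def, hT.le] using this

lemma continuousOn_integral_of_bound {X : Type*} [TopologicalSpace X] [MeasurableSpace X]
    [OpensMeasurableSpace X] {ν : ℝ → ProbabilityMeasure X} {s : Set ℝ} (hν : ContinuousOn ν s)
    {f : X → ℝ} (hf : Continuous f) {K : ℝ} (hK : ∀ x, |f x| ≤ K) :
    ContinuousOn (fun t => ∫ x, f x ∂(ν t : Measure X)) s := by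
  obtain ⟨g, hg⟩ := hf.exists_boundedContinuousFunction hK
  simp_rw [← hg]
  exact (ProbabilityMeasure.continuous_integral_boundedContinuousFunction g).comp_continuousOn hν

lemma continuousOn_integral_integral_of_bound {X : Type*} [TopologicalSpace X] [MeasurableSpace X]
    [TopologicalSpace.PseudoMetrizableSpace X] [SecondCountableTopology X] [BorelSpace X]
    {ν : ℝ → ProbabilityMeasure X} {s : Set ℝ} (hν : ContinuousOn ν s)
    {f : X × X → ℝ} (hf : Continuous f) {K : ℝ} (hK : ∀ x, |f x| ≤ K) :
    ContinuousOn (fun t => ∫ x, ∫ y, f (x, y) ∂(ν t : Measure X) ∂(ν t : Measure X)) s := by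
  have h2 : ContinuousOn (fun t => (ν t).prod (ν t)) s :=
    ProbabilityMeasure.continuous_prod.comp_continuousOn (hν.prodMk hν)
  refine (continuousOn_integral_of_bound h2 hf hK).congr fun t _ => ?_
  simp only [ProbabilityMeasure.toMeasure_prod]
  exact (integral_prod f (integrable_of_continuous_of_bound hf hK)).symm

section TestFn

variable {d : ℕ} {φ : Phase d → ℝ}

lemma IsTestFn.fderiv_apply (hφ : IsTestFn φ) (v : Phase d) :
    IsTestFn (fun x => fderiv ℝ φ x v) :=
  ⟨(hφ.1.fderiv_right (m := (⊤ : ℕ∞)) (by simp)).clm_apply contDiff_const,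
    hφ.2.fderiv_apply (𝕜 := ℝ) v⟩

lemma IsTestFn.mul_continuous (hφ : IsTestFn φ) {u : Phase d → ℝ} (hu : Continuous u) :
    ∃ K, ∀ x, |u x * φ x| ≤ K :=
  (hu.mul hφ.1.continuous).bounded_above_of_compact_support hφ.2.mul_left

lemma IsTestFn.bounded (hφ : IsTestFn φ) : ∃ K, ∀ x, |φ x| ≤ K :=
  hφ.1.continuous.bounded_above_of_compact_support hφ.2

lemma continuous_sum_of_bound {X ι : Type*} [TopologicalSpace X] [Fintype ι] {u : ι → X → ℝ}
    (hu : ∀ i, Continuous (u i) ∧ ∃ K, ∀ x, |u i x| ≤ K) :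
    Continuous (fun x => ∑ i, u i x) ∧ ∃ K, ∀ x, |∑ i, u i x| ≤ K := by
  choose hc K hK using hu
  exact ⟨continuous_finsetSum _ fun i _ => hc i, ∑ i, K i, fun x =>
    (Finset.abs_sum_le_sum_abs _ _).trans (Finset.sum_le_sum fun i _ => hK i x)⟩

lemma IsTestFn.laplP_bounded (hφ : IsTestFn φ) :
    Continuous (laplP φ) ∧ ∃ K, ∀ x, |laplP φ x| ≤ K :=
  continuous_sum_of_bound fun i =>
    ⟨((hφ.fderiv_apply (dirP i)).fderiv_apply (dirP i)).1.continuous,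
      ((hφ.fderiv_apply (dirP i)).fderiv_apply (dirP i)).bounded⟩

lemma IsTestFn.ouP_bounded (hφ : IsTestFn φ) (m : ℝ) :
    Continuous (ouP m φ) ∧ ∃ K, ∀ x, |ouP m φ x| ≤ K := by
  obtain ⟨h1, K1, hK1⟩ := hφ.laplP_bounded
  obtain ⟨h2, K2, hK2⟩ := continuous_sum_of_bound (u := fun i x => x.2 i * pdP φ x i) fun i =>
    ⟨by exact Continuous.mul (by fun_prop) (hφ.fderiv_apply (dirP i)).1.continuous,
      (hφ.fderiv_apply (dirP i)).mul_continuous (u := fun x => x.2 i) (by fun_prop)⟩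
  refine ⟨h1.sub (continuous_const.mul h2), K1 + |1 / m| * K2, fun x => ?_⟩
  refine (abs_sub _ _).trans (add_le_add (hK1 x) ?_)
  rw [abs_mul]
  exact mul_le_mul_of_nonneg_left (hK2 x) (abs_nonneg _)

lemma IsTestFn.transport_bounded (hφ : IsTestFn φ) (m : ℝ) {V : (Fin d → ℝ) → ℝ}
    (hV : ContDiff ℝ 2 V) :
    Continuous (transport m V φ) ∧ ∃ K, ∀ x, |transport m V φ x| ≤ K := by
  obtain ⟨h1, K1, hK1⟩ := continuous_sum_of_bound
    (u := fun i x => (x.2 i / m) * fderiv ℝ φ x (dirQ i)) fun i =>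
    ⟨by exact Continuous.mul (by fun_prop) (hφ.fderiv_apply (dirQ i)).1.continuous,
      (hφ.fderiv_apply (dirQ i)).mul_continuous (u := fun x => x.2 i / m) (by fun_prop)⟩
  have hV' : ∀ i, Continuous fun x : Phase d => fderiv ℝ V x.1 (Pi.single i 1) := fun i =>
    ((hV.continuous_fderiv (by norm_num)).comp continuous_fst).clm_apply continuous_const
  obtain ⟨h2, K2, hK2⟩ := continuous_sum_of_bound
    (u := fun i x => fderiv ℝ V x.1 (Pi.single i 1) * pdP φ x i) fun i =>
    ⟨by exact Continuous.mul (hV' i) (hφ.fderiv_apply (dirP i)).1.continuous,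
      (hφ.fderiv_apply (dirP i)).mul_continuous (hV' i)⟩
  exact ⟨h1.sub h2, K1 + K2, fun x => (abs_sub _ _).trans (add_le_add (hK1 x) (hK2 x))⟩

lemma IsTestFn.sum_pdP_sq_bounded (hφ : IsTestFn φ) :
    Continuous (fun x => ∑ i, (pdP φ x i) ^ 2) ∧ ∃ K, ∀ x, |∑ i, (pdP φ x i) ^ 2| ≤ K :=
  continuous_sum_of_bound fun i => by
    have h := hφ.fderiv_apply (dirP i)
    refine ⟨h.1.continuous.pow 2, ?_⟩
    simpa only [sq, pdP] using h.mul_continuous h.1.continuous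

/-- The integrand of the mean-field force term tested against `φ`. -/
def meanFieldKernel (ψ : (Fin d → ℝ) → ℝ) (φ : Phase d → ℝ) (z : Phase d × Phase d) : ℝ :=
  ∑ i, fderiv ℝ ψ (z.1.1 - z.2.1) (Pi.single i 1) * pdP φ z.1 i

lemma IsTestFn.meanFieldKernel_bounded (hφ : IsTestFn φ) {ψ : (Fin d → ℝ) → ℝ}
    (hψ : ContDiff ℝ 2 ψ) (hb : ∃ K, ∀ q, ‖fderiv ℝ ψ q‖ ≤ K ∧ ‖fderiv ℝ (fderiv ℝ ψ) q‖ ≤ K) :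
    Continuous (meanFieldKernel ψ φ) ∧ ∃ K, ∀ z, |meanFieldKernel ψ φ z| ≤ K := by
  obtain ⟨K, hK⟩ := hb
  refine continuous_sum_of_bound fun i => ?_
  have h := hφ.fderiv_apply (dirP i)
  obtain ⟨L, hL⟩ := h.bounded
  constructor
  · refine Continuous.mul ?_ (h.1.continuous.comp continuous_fst)
    exact ((hψ.continuous_fderiv (by norm_num)).comp (by fun_prop)).clm_apply continuous_const
  · refine ⟨K * L, fun z => ?_⟩
    rw [abs_mul]
    refine mul_le_mul ?_ (hL _) (abs_nonneg _) ((norm_nonneg _).trans (hK 0).1)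
    refine ((fderiv ℝ ψ (z.1.1 - z.2.1)).le_opNorm _).trans ?_
    simpa [Pi.norm_single] using (hK (z.1.1 - z.2.1)).1

lemma fderiv_mul_prod {χ : ℝ → ℝ} (hχ : Differentiable ℝ χ) (hφ : Differentiable ℝ φ)
    (z : ℝ × Phase d) (v : ℝ × Phase d) :
    fderiv ℝ (fun z : ℝ × Phase d => χ z.1 * φ z.2) z v =
      v.1 * deriv χ z.1 * φ z.2 + χ z.1 * fderiv ℝ φ z.2 v.2 := by
  have h1 : HasFDerivAt (fun z : ℝ × Phase d => χ z.1)
      ((fderiv ℝ χ z.1).comp (ContinuousLinearMap.fst ℝ ℝ (Phase d))) z :=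
    (hχ z.1).hasFDerivAt.comp z hasFDerivAt_fst
  have h2 : HasFDerivAt (fun z : ℝ × Phase d => φ z.2)
      ((fderiv ℝ φ z.2).comp (ContinuousLinearMap.snd ℝ ℝ (Phase d))) z :=
    (hφ z.2).hasFDerivAt.comp z hasFDerivAt_snd
  have h := (h1.mul h2).fderiv
  rw [show (fun z : ℝ × Phase d => χ z.1) * (fun z : ℝ × Phase d => φ z.2)
    = fun z => χ z.1 * φ z.2 from rfl] at h
  rw [h]
  have h3 : fderiv ℝ χ z.1 v.1 = v.1 * deriv χ z.1 := by
    rw [fderiv_eq_smul_deriv, smul_eq_mul]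
  simp [h3]
  ring

lemma Lop_mul_prod {m γ : ℝ} {V ψ : (Fin d → ℝ) → ℝ} (ν : Measure (Phase d)) {χ : ℝ → ℝ}
    (hχ : Differentiable ℝ χ) (hφ : IsTestFn φ) (t : ℝ) (x : Phase d) :
    Lop m γ V ψ ν (fun z => χ z.1 * φ z.2) (t, x) =
      χ t * (γ * (transport m V φ x - ∑ i, convGradPsi ψ ν x.1 i * pdP φ x i)
        + γ ^ 2 * ouP m φ x) := by
  have hd : Differentiable ℝ φ := hφ.1.differentiable (by simp)
  have hq : ∀ z i, qderT (fun z : ℝ × Phase d => χ z.1 * φ z.2) z i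
      = χ z.1 * fderiv ℝ φ z.2 (dirQ i) := fun z i => by
    simp [qderT, fderiv_mul_prod hχ hd]
  have hp : ∀ z i, pderT (fun z : ℝ × Phase d => χ z.1 * φ z.2) z i
      = χ z.1 * pdP φ z.2 i := fun z i => by
    simp [pderT, pdP, fderiv_mul_prod hχ hd]
  have hl : laplPT (fun z : ℝ × Phase d => χ z.1 * φ z.2) (t, x) = χ t * laplP φ x := by
    unfold laplPT laplP
    rw [Finset.mul_sum]
    refine Finset.sum_congr rfl fun i _ => ?_
    simp_rw [hp]
    have := fderiv_mul_prod hχ ((hφ.fderiv_apply (dirP i)).1.differentiable (by simp))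
      (t, x) (0, dirP i)
    simp only [zero_mul, zero_add] at this
    exact this
  unfold Lop transport ouP
  rw [hl]
  simp only [hq, hp, add_mul, Finset.sum_add_distrib]
  have e1 : ∀ a b c : ℝ, a * (b * c) = b * (a * c) := fun a b c => by ring
  have e2 : ∑ i, x.2 i / m * pdP φ x i = 1 / m * ∑ i, x.2 i * pdP φ x i := by
    rw [Finset.mul_sum]
    exact Finset.sum_congr rfl fun i _ => by ring
  simp only [e1 _ (χ t) _, ← Finset.mul_sum, e2]
  ring

end TestFn

section APriori

lemma integral_add_const_mul_add {X : Type*} [MeasurableSpace X] {μ : Measure X} {f g h : X → ℝ}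
    (hf : Integrable f μ) (hg : Integrable g μ) (hh : Integrable h μ) (c e : ℝ) :
    ∫ x, (f x + (c * g x + e * h x)) ∂μ = (∫ x, f x ∂μ) + (c * (∫ x, g x ∂μ) + e * ∫ x, h x ∂μ) := by
  have h1 : Integrable (fun x => c * g x) μ := hg.const_mul c
  have h2 : Integrable (fun x => e * h x) μ := hh.const_mul e
  have h3 : Integrable (fun x => c * g x + e * h x) μ := h1.add h2
  rw [integral_add hf h3, integral_add h1 h2, integral_const_mul, integral_const_mul]

variable {d : ℕ} {m : ℝ} {V ψ : (Fin d → ℝ) → ℝ} {φ : Phase d → ℝ} {χ : ℝ → ℝ} {T : ℝ}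

/-- The expression inside the supremum defining `RateI`, for the test function `χ(t) φ(x)`. -/
lemma RateI_mul_prod_le (hφ : IsTestFn φ) (hχ : ContDiff ℝ (⊤ : ℕ∞) χ) (hχs : HasCompactSupport χ)
    {γ : ℝ} {ν : ℝ → ProbabilityMeasure (Phase d)} {C : ℝ≥0∞} (hC : C ≠ ⊤)
    (h : RateI m γ T V ψ ν ≤ C) :
    (χ T * ∫ x, φ x ∂(ν T : Measure (Phase d))) - (χ 0 * ∫ x, φ x ∂(ν 0 : Measure (Phase d)))
      - (∫ t in Icc (0 : ℝ) T, (∫ x, (deriv χ t * φ x + χ t *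
          (γ * (transport m V φ x - ∑ i, convGradPsi ψ (ν t : Measure (Phase d)) x.1 i * pdP φ x i)
            + γ ^ 2 * ouP m φ x)) ∂(ν t : Measure (Phase d))))
      - γ ^ 2 / 2 * ∫ t in Icc (0 : ℝ) T,
          χ t ^ 2 * (∫ x, (∑ i, (pdP φ x i) ^ 2) ∂(ν t : Measure (Phase d))) ≤ C.toReal := by
  have hχd : Differentiable ℝ χ := hχ.differentiable (by simp)
  have hφd : Differentiable ℝ φ := hφ.1.differentiable (by simp)
  have hcb : IsCb2 (fun z : ℝ × Phase d => χ z.1 * φ z.2) := by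
    refine HasCompactSupport.isCb2 ?_ ?_
    · exact contDiff_infty.1 ((hχ.comp contDiff_fst).mul (hφ.1.comp contDiff_snd)) 2
    · refine HasCompactSupport.intro (hχs.isCompact.prod hφ.2.isCompact) fun z hz => ?_
      by_cases h1 : z.1 ∈ tsupport χ
      · have h2 : z.2 ∉ tsupport φ := fun h2 => hz ⟨h1, h2⟩
        simp [image_eq_zero_of_notMem_tsupport h2]
      · simp [image_eq_zero_of_notMem_tsupport h1]
  have h1 := (le_iSup (fun f : {f : ℝ × Phase d → ℝ // IsCb2 f} => ENNReal.ofReal (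
      (∫ x, f.1 (T, x) ∂(ν T : Measure (Phase d)))
      - (∫ x, f.1 (0, x) ∂(ν 0 : Measure (Phase d)))
      - (∫ t in Icc (0 : ℝ) T,
          (∫ x, (tder f.1 (t, x) + Lop m γ V ψ (ν t : Measure (Phase d)) f.1 (t, x))
            ∂(ν t : Measure (Phase d))))
      - γ ^ 2 / 2 * ∫ t in Icc (0 : ℝ) T,
          (∫ x, (∑ i, (pderT f.1 (t, x) i) ^ 2) ∂(ν t : Measure (Phase d))))) ⟨_, hcb⟩).trans h
  have h2 := (ENNReal.ofReal_le_iff_le_toReal hC).1 h1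
  have ht : ∀ t x, tder (fun z : ℝ × Phase d => χ z.1 * φ z.2) (t, x) = deriv χ t * φ x :=
    fun t x => by simp [tder, fderiv_mul_prod hχd hφd]
  have hp : ∀ t x i, pderT (fun z : ℝ × Phase d => χ z.1 * φ z.2) (t, x) i
      = χ t * pdP φ x i := fun t x i => by
    simp [pderT, pdP, fderiv_mul_prod hχd hφd]
  simp only [ht, hp, Lop_mul_prod _ hχd hφ, mul_pow, ← Finset.mul_sum, integral_const_mul] at h2
  exact h2

lemma integral_generator_eq (hyp : PotentialHyp d m V ψ) (hφ : IsTestFn φ)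
    (ν : Measure (Phase d)) [IsProbabilityMeasure ν] (a b c e : ℝ) :
    ∫ x, (a * φ x + b * (c * (transport m V φ x - ∑ i, convGradPsi ψ ν x.1 i * pdP φ x i)
      + e * ouP m φ x)) ∂ν =
    a * ∫ x, φ x ∂ν + b * (c * ((∫ x, transport m V φ x ∂ν)
      - ∫ x, ∫ y, meanFieldKernel ψ φ (x, y) ∂ν ∂ν) + e * ∫ x, ouP m φ x ∂ν) := by
  obtain ⟨K0, h0⟩ := hφ.bounded
  obtain ⟨c1, K1, h1⟩ := hφ.transport_bounded m hyp.V_smooth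
  obtain ⟨c2, K2, h2⟩ := hφ.meanFieldKernel_bounded hyp.ψ_smooth hyp.ψ_deriv_bdd
  obtain ⟨c3, K3, h3⟩ := hφ.ouP_bounded m
  have i0 := integrable_of_continuous_of_bound (μ := ν) hφ.1.continuous h0
  have i1 := integrable_of_continuous_of_bound (μ := ν) c1 h1
  have i2 := (integrable_of_continuous_of_bound (μ := ν.prod ν) c2 h2).integral_prod_left
  have i3 := integrable_of_continuous_of_bound (μ := ν) c3 h3
  have key : ∀ x : Phase d, ∑ i, convGradPsi ψ ν x.1 i * pdP φ x i
      = ∫ y, meanFieldKernel ψ φ (x, y) ∂ν := fun x => by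
    unfold meanFieldKernel
    obtain ⟨K, hK⟩ := hyp.ψ_deriv_bdd
    rw [integral_finsetSum]
    · exact Finset.sum_congr rfl fun i _ => (integral_mul_const _ _).symm
    · intro i _
      have hi : Integrable (fun y : Phase d => fderiv ℝ ψ (x.1 - y.1) (Pi.single i 1)) ν := by
        refine integrable_of_continuous_of_bound (K := K) ?_ fun y => ?_
        · exact ((hyp.ψ_smooth.continuous_fderiv (by norm_num)).comp (by fun_prop)).clm_apply
            continuous_const
        · refine ((fderiv ℝ ψ (x.1 - y.1)).le_opNorm _).trans ?_
          simpa [Pi.norm_single] using (hK (x.1 - y.1)).1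
      exact hi.mul_const (pdP φ x i)
  simp only [key]
  have i4 : Integrable
    (fun x => transport m V φ x - ∫ y, meanFieldKernel ψ φ (x, y) ∂ν) ν := i1.sub i2
  have h := integral_add_const_mul_add (i0.const_mul a) i4 i3 (b * c) (b * e)
  rw [integral_const_mul, integral_sub i1 i2] at h
  rw [mul_add, ← mul_assoc, ← mul_assoc, ← h]
  congr 1 with x
  ring

/-- The fast (order `γ²`) part of the duality expression is controlled by the slow part. -/
lemma exists_fast_bound (hyp : PotentialHyp d m V ψ) (hφ : IsTestFn φ)
    (hχ : ContDiff ℝ (⊤ : ℕ∞) χ) (hχs : HasCompactSupport χ) (hT : 0 < T) {C : ℝ≥0∞} (hC : C ≠ ⊤) :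
    ∃ K L : ℝ, ∀ γ : ℝ, 0 < γ → ∀ ν : ℝ → ProbabilityMeasure (Phase d),
      ContinuousOn ν (Icc 0 T) → RateI m γ T V ψ ν ≤ C →
      -(γ ^ 2 * ((∫ t in Icc (0 : ℝ) T, χ t * ∫ x, ouP m φ x ∂(ν t : Measure (Phase d)))
        + 1 / 2 * ∫ t in Icc (0 : ℝ) T,
          χ t ^ 2 * (∫ x, (∑ i, (pdP φ x i) ^ 2) ∂(ν t : Measure (Phase d))))) ≤ K + L * γ := by
  obtain ⟨K0, h0⟩ := hφ.bounded
  obtain ⟨c1, K1, h1⟩ := hφ.transport_bounded m hyp.V_smooth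
  obtain ⟨c2, K2, h2⟩ := hφ.meanFieldKernel_bounded hyp.ψ_smooth hyp.ψ_deriv_bdd
  obtain ⟨c3, K3, h3⟩ := hφ.ouP_bounded m
  obtain ⟨X0, hX0⟩ : ∃ K, ∀ t, |χ t| ≤ K :=
    hχ.continuous.bounded_above_of_compact_support hχs
  have hχ' : Continuous (deriv χ) := hχ.continuous_deriv (by simp)
  obtain ⟨X1, hX1⟩ : ∃ K, ∀ t, |deriv χ t| ≤ K :=
    hχ'.bounded_above_of_compact_support hχs.deriv
  have hX0n : 0 ≤ X0 := (abs_nonneg _).trans (hX0 0)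
  have hX1n : 0 ≤ X1 := (abs_nonneg _).trans (hX1 0)
  refine ⟨C.toReal + 2 * (X0 * K0) + X1 * K0 * T, X0 * (K1 + K2) * T, fun γ hγ ν hν hI => ?_⟩
  have hA : ContinuousOn (fun t => deriv χ t * ∫ x, φ x ∂(ν t : Measure (Phase d))) (Icc 0 T) :=
    hχ'.continuousOn.mul (continuousOn_integral_of_bound hν hφ.1.continuous h0)
  have hB : ContinuousOn (fun t => χ t * ((∫ x, transport m V φ x ∂(ν t : Measure (Phase d)))
      - ∫ x, ∫ y, meanFieldKernel ψ φ (x, y) ∂(ν t : Measure (Phase d))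
        ∂(ν t : Measure (Phase d)))) (Icc 0 T) :=
    hχ.continuous.continuousOn.mul ((continuousOn_integral_of_bound hν c1 h1).sub
      (continuousOn_integral_integral_of_bound hν c2 h2))
  have hD : ContinuousOn (fun t => χ t * ∫ x, ouP m φ x ∂(ν t : Measure (Phase d))) (Icc 0 T) :=
    hχ.continuous.continuousOn.mul (continuousOn_integral_of_bound hν c3 h3)
  have bA : |∫ t in Icc (0 : ℝ) T, deriv χ t * ∫ x, φ x ∂(ν t : Measure (Phase d))|
      ≤ X1 * K0 * T := abs_setIntegral_Icc_le hT fun t => by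
    rw [abs_mul]
    exact mul_le_mul (hX1 t) (abs_integral_le_of_bound h0) (abs_nonneg _) hX1n
  have bB : |∫ t in Icc (0 : ℝ) T, χ t * ((∫ x, transport m V φ x ∂(ν t : Measure (Phase d)))
      - ∫ x, ∫ y, meanFieldKernel ψ φ (x, y) ∂(ν t : Measure (Phase d))
        ∂(ν t : Measure (Phase d)))| ≤ X0 * (K1 + K2) * T := abs_setIntegral_Icc_le hT fun t => by
    rw [abs_mul]
    refine mul_le_mul (hX0 t) ?_ (abs_nonneg _) hX0n
    refine (abs_sub _ _).trans (add_le_add (abs_integral_le_of_bound h1) ?_)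
    exact abs_integral_le_of_bound fun x => abs_integral_le_of_bound fun y => h2 _
  have bE : ∀ s, |χ s * ∫ x, φ x ∂(ν s : Measure (Phase d))| ≤ X0 * K0 := fun s => by
    rw [abs_mul]
    exact mul_le_mul (hX0 s) (abs_integral_le_of_bound h0) (abs_nonneg _) hX0n
  have hmain := RateI_mul_prod_le hφ hχ hχs hC hI
  simp only [integral_generator_eq hyp hφ] at hmain
  have hs := integral_add_const_mul_add (μ := volume.restrict (Icc 0 T)) hA.integrableOn_Icc
    hB.integrableOn_Icc hD.integrableOn_Icc γ (γ ^ 2)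
  have hs' : ∀ t, deriv χ t * (∫ x, φ x ∂(ν t : Measure (Phase d))) + χ t *
      (γ * ((∫ x, transport m V φ x ∂(ν t : Measure (Phase d)))
      - ∫ x, ∫ y, meanFieldKernel ψ φ (x, y) ∂(ν t : Measure (Phase d))
        ∂(ν t : Measure (Phase d))) + γ ^ 2 * ∫ x, ouP m φ x ∂(ν t : Measure (Phase d))) =
      deriv χ t * (∫ x, φ x ∂(ν t : Measure (Phase d))) +
      (γ * (χ t * ((∫ x, transport m V φ x ∂(ν t : Measure (Phase d)))
      - ∫ x, ∫ y, meanFieldKernel ψ φ (x, y) ∂(ν t : Measure (Phase d))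
        ∂(ν t : Measure (Phase d)))) + γ ^ 2 * (χ t *
          ∫ x, ouP m φ x ∂(ν t : Measure (Phase d)))) := fun t => by ring
  simp only [hs', hs] at hmain
  have e1 := (abs_le.1 (bE T)).1
  have e2 := (abs_le.1 (bE 0)).2
  have e3 := (abs_le.1 bA).2
  have e4 := mul_le_mul_of_nonneg_left (abs_le.1 bB).2 hγ.le
  linarith

end APriori

section Limit

variable {d : ℕ} {m T : ℝ} {V ψ : (Fin d → ℝ) → ℝ} {φ : Phase d → ℝ}
  {ρseq : ℕ → ℝ → ProbabilityMeasure (Phase d)} {ρ : ℝ → ProbabilityMeasure (Phase d)}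

lemma integrableOn_integral_of_tendsto (hT : 0 < T)
    (hρcont : ∀ n, ContinuousOn (ρseq n) (Icc 0 T))
    (hconv : ∀ F : BoundedContinuousFunction (ℝ × Phase d) ℝ,
      Tendsto
        (fun n => ∫ t in Icc (0 : ℝ) T,
          (∫ x, F (t, x) ∂(ρseq n t : Measure (Phase d))))
        atTop
        (𝓝 (∫ t in Icc (0 : ℝ) T, (∫ x, F (t, x) ∂(ρ t : Measure (Phase d))))))
    {g : Phase d → ℝ} (hg : Continuous g) {K : ℝ} (hK : ∀ x, |g x| ≤ K) :
    IntegrableOn (fun t => ∫ x, g x ∂(ρ t : Measure (Phase d))) (Icc 0 T) := by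
  by_contra h
  have hadd : ∀ ν : ProbabilityMeasure (Phase d), ∫ x, (g x + 1) ∂(ν : Measure (Phase d))
      = ∫ x, g x ∂(ν : Measure (Phase d)) + 1 := fun ν => by
    rw [integral_add (integrable_of_continuous_of_bound hg hK) (integrable_const _)]
    simp
  have h' : ¬ IntegrableOn (fun t => ∫ x, (g x + 1) ∂(ρ t : Measure (Phase d))) (Icc 0 T) := by
    intro hi
    simp only [hadd] at hi
    exact h ((hi.sub (integrableOn_const (C := (1 : ℝ)) (by simp))).congr_fun
      (fun t _ => by simp) measurableSet_Icc)
  obtain ⟨F, hF⟩ := (hg.comp continuous_snd).exists_boundedContinuousFunction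
    (fun z : ℝ × Phase d => hK z.2)
  have l1 := hconv F
  have l2 := hconv (F + BoundedContinuousFunction.const _ 1)
  simp only [hF, BoundedContinuousFunction.coe_add, Pi.add_apply, Function.comp_apply,
    BoundedContinuousFunction.const_apply] at l1 l2
  rw [integral_undef h] at l1
  rw [integral_undef h'] at l2
  have hn : ∀ n, ∫ t in Icc (0 : ℝ) T, ∫ x, (g x + 1) ∂(ρseq n t : Measure (Phase d))
      = (∫ t in Icc (0 : ℝ) T, ∫ x, g x ∂(ρseq n t : Measure (Phase d))) + T := fun n => by
    simp only [hadd]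
    rw [integral_add (continuousOn_integral_of_bound (hρcont n) hg hK).integrableOn_Icc
      (integrableOn_const (by simp))]
    simp [hT.le]
  simp only [hn] at l2
  have := tendsto_nhds_unique l2 (l1.add_const T)
  linarith

lemma eq_zero_of_forall_nonneg_mul_add_sq {b c : ℝ} (h : ∀ ε : ℝ, 0 ≤ ε * b + ε ^ 2 * c) :
    b = 0 := by
  have hk : 0 < |c| + 1 := by positivity
  have h1 := h (-b / (2 * (|c| + 1)))
  have h2 : (-b / (2 * (|c| + 1))) ^ 2 * c ≤ (-b / (2 * (|c| + 1))) ^ 2 * (|c| + 1) :=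
    mul_le_mul_of_nonneg_left (by linarith [le_abs_self c]) (sq_nonneg _)
  have h3 : -b / (2 * (|c| + 1)) * b + (-b / (2 * (|c| + 1))) ^ 2 * (|c| + 1)
      = -(b ^ 2 / (4 * (|c| + 1))) := by
    field_simp
    ring
  have h4 : b ^ 2 / (4 * (|c| + 1)) ≤ 0 := by linarith
  have h5 : b ^ 2 ≤ 0 := by
    by_contra hb
    push Not at hb
    have : 0 < b ^ 2 / (4 * (|c| + 1)) := by positivity
    linarith
  exact pow_eq_zero_iff (two_ne_zero) |>.1 (le_antisymm h5 (sq_nonneg b))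

variable (hyp : PotentialHyp d m V ψ) (hT : 0 < T)
    {γs : ℕ → ℝ} (hγpos : ∀ n, 0 < γs n) (hγ : Tendsto γs atTop atTop)
    (hρcont : ∀ n, ContinuousOn (ρseq n) (Icc 0 T))
    {C : ℝ≥0∞} (hC : C ≠ ⊤)
    (hbound : ∀ n, RateI m (γs n) T V ψ (ρseq n) ≤ C)
    (hconv : ∀ F : BoundedContinuousFunction (ℝ × Phase d) ℝ,
      Tendsto
        (fun n => ∫ t in Icc (0 : ℝ) T,
          (∫ x, F (t, x) ∂(ρseq n t : Measure (Phase d))))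
        atTop
        (𝓝 (∫ t in Icc (0 : ℝ) T, (∫ x, F (t, x) ∂(ρ t : Measure (Phase d))))))
include hyp hT hγpos hγ hρcont hC hbound hconv

lemma fast_limit_nonneg (hφ : IsTestFn φ) {χ : ℝ → ℝ} (hχ : ContDiff ℝ (⊤ : ℕ∞) χ)
    (hχs : HasCompactSupport χ) :
    0 ≤ (∫ t in Icc (0 : ℝ) T, χ t * ∫ x, ouP m φ x ∂(ρ t : Measure (Phase d)))
        + 1 / 2 * ∫ t in Icc (0 : ℝ) T,
          χ t ^ 2 * (∫ x, (∑ i, (pdP φ x i) ^ 2) ∂(ρ t : Measure (Phase d))) := by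
  obtain ⟨K, L, hKL⟩ := exists_fast_bound hyp hφ hχ hχs hT hC
  obtain ⟨X, hX⟩ : ∃ K, ∀ t, |χ t| ≤ K :=
    hχ.continuous.bounded_above_of_compact_support hχs
  obtain ⟨c1, K1, h1⟩ := hφ.ouP_bounded m
  obtain ⟨c2, K2, h2⟩ := hφ.sum_pdP_sq_bounded
  have hX0 : 0 ≤ X := (abs_nonneg _).trans (hX 0)
  obtain ⟨F1, hF1⟩ := Continuous.exists_boundedContinuousFunction
    (f := fun z : ℝ × Phase d => χ z.1 * ouP m φ z.2)
    ((hχ.continuous.comp continuous_fst).mul (c1.comp continuous_snd)) (K := X * K1) fun z => by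
      rw [abs_mul]; exact mul_le_mul (hX _) (h1 _) (abs_nonneg _) hX0
  obtain ⟨F2, hF2⟩ := Continuous.exists_boundedContinuousFunction
    (f := fun z : ℝ × Phase d => χ z.1 ^ 2 * ∑ i, (pdP φ z.2 i) ^ 2)
    (((hχ.continuous.comp continuous_fst).pow 2).mul (c2.comp continuous_snd))
    (K := X ^ 2 * K2) fun z => by
      rw [abs_mul, abs_pow]
      exact mul_le_mul (pow_le_pow_left₀ (abs_nonneg _) (hX _) 2) (h2 _) (abs_nonneg _)
        (sq_nonneg _)
  have l1 := hconv F1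
  have l2 := hconv F2
  simp only [hF1, hF2, integral_const_mul] at l1 l2
  have l3 := l1.add (l2.const_mul (1 / 2))
  have l4 : Tendsto (fun n => -(K * ((γs n)⁻¹ * (γs n)⁻¹) + L * (γs n)⁻¹)) atTop (𝓝 0) := by
    have hi := tendsto_inv_atTop_zero.comp hγ
    simpa using (((hi.mul hi).const_mul K).add (hi.const_mul L)).neg
  refine le_of_tendsto_of_tendsto' l4 l3 fun n => ?_
  have hb := hKL (γs n) (hγpos n) (ρseq n) (hρcont n) (hbound n)
  have hp := hγpos n
  have hb' := mul_le_mul_of_nonneg_left hb (a := (γs n)⁻¹ * (γs n)⁻¹) (by positivity)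
  have e1 : ∀ y : ℝ, (γs n)⁻¹ * (γs n)⁻¹ * -((γs n) ^ 2 * y) = - y := fun y => by field_simp
  have e2 : (γs n)⁻¹ * (γs n)⁻¹ * (K + L * γs n)
      = K * ((γs n)⁻¹ * (γs n)⁻¹) + L * (γs n)⁻¹ := by field_simp
  rw [e1, e2] at hb'
  linarith

/-- For almost every time the limit measure annihilates the range of the
Ornstein–Uhlenbeck generator on test functions. -/
lemma ae_integral_ouP_eq_zero (hφ : IsTestFn φ) :
    ∀ᵐ t ∂(volume.restrict (Icc (0 : ℝ) T)), ∫ x, ouP m φ x ∂(ρ t : Measure (Phase d)) = 0 := by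
  obtain ⟨c1, K1, h1⟩ := hφ.ouP_bounded m
  have hint := integrableOn_integral_of_tendsto hT hρcont hconv c1 h1
  refine ae_eq_zero_of_integral_contDiff_smul_eq_zero
    (Integrable.locallyIntegrable hint) fun χ hχ hχs => ?_
  simp only [smul_eq_mul]
  refine eq_zero_of_forall_nonneg_mul_add_sq
    (c := 1 / 2 * ∫ t in Icc (0 : ℝ) T,
          χ t ^ 2 * (∫ x, (∑ i, (pdP φ x i) ^ 2) ∂(ρ t : Measure (Phase d)))) fun ε => ?_
  have h := fast_limit_nonneg hyp hT hγpos hγ hρcont hC hbound hconv hφ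
    (χ := fun t => ε * χ t) (contDiff_const.mul hχ) hχs.mul_left
  simp only [mul_pow, mul_assoc, integral_const_mul] at h
  linarith

end Limit

section Truncation

/-- A smooth function vanishing on `(-∞, 1]` whose derivative is a smooth step from `0` to `1`. -/
def smoothRamp (y : ℝ) : ℝ := ∫ u in (1 : ℝ)..y, Real.smoothTransition (u - 1)

lemma hasDerivAt_smoothRamp (y : ℝ) :
    HasDerivAt smoothRamp (Real.smoothTransition (y - 1)) y := by
  have hc : Continuous fun u : ℝ => Real.smoothTransition (u - 1) :=
    Real.smoothTransition.continuous.comp (by fun_prop)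
  exact hc.integral_hasStrictDerivAt 1 y |>.hasDerivAt

lemma contDiff_smoothRamp : ContDiff ℝ (⊤ : ℕ∞) smoothRamp := by
  refine contDiff_infty_iff_deriv.2 ⟨fun y => (hasDerivAt_smoothRamp y).differentiableAt, ?_⟩
  rw [show deriv smoothRamp = fun y => Real.smoothTransition (y - 1) from
    funext fun y => (hasDerivAt_smoothRamp y).deriv]
  exact Real.smoothTransition.contDiff.comp (contDiff_id.sub contDiff_const)

lemma smoothRamp_of_le_one {y : ℝ} (hy : y ≤ 1) : smoothRamp y = 0 := by
  refine intervalIntegral.integral_zero_ae (ae_of_all _ fun u hu => ?_)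
  rw [uIoc_of_ge hy] at hu
  exact Real.smoothTransition.zero_of_nonpos (by linarith [hu.2])

lemma deriv_smoothTransition_eq_zero {y : ℝ} (hy : y < 0 ∨ 1 < y) :
    deriv Real.smoothTransition y = 0 := by
  rcases hy with hy | hy
  · have : Real.smoothTransition =ᶠ[𝓝 y] fun _ => 0 := by
      filter_upwards [Iio_mem_nhds hy] with u hu
      exact Real.smoothTransition.zero_of_nonpos (le_of_lt hu)
    rw [this.deriv_eq, deriv_const]
  · have : Real.smoothTransition =ᶠ[𝓝 y] fun _ => 1 := by
      filter_upwards [Ioi_mem_nhds hy] with u hu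
      exact Real.smoothTransition.one_of_one_le (le_of_lt hu)
    rw [this.deriv_eq, deriv_const]

lemma exists_bound_mul_deriv_smoothTransition :
    ∃ K, ∀ y : ℝ, |y * deriv Real.smoothTransition (y - 1)| ≤ K := by
  have hc : Continuous fun y : ℝ => y * deriv Real.smoothTransition (y - 1) :=
    continuous_id.mul (((Real.smoothTransition.contDiff (n := 1)).continuous_deriv (by simp)).comp
      (by fun_prop))
  refine hc.bounded_above_of_compact_support
    (HasCompactSupport.intro (isCompact_Icc (a := (1 : ℝ)) (b := 2)) fun y hy => ?_)
  rw [mem_Icc, not_and_or, not_le, not_le] at hy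
  rw [deriv_smoothTransition_eq_zero, mul_zero]
  rcases hy with hy | hy
  · left; linarith
  · right; linarith

variable {d : ℕ}

lemma ouP_comp {m : ℝ} {f : Phase d → ℝ} {g g' g'' : ℝ → ℝ} (hf : ContDiff ℝ 2 f)
    (hg : ∀ y, HasDerivAt g (g' y) y) (hg' : ∀ y, HasDerivAt g' (g'' y) y) (x : Phase d) :
    ouP m (fun y => g (f y)) x
      = g' (f x) * ouP m f x + g'' (f x) * ∑ i, (pdP f x i) ^ 2 := by
  have hd : Differentiable ℝ f := hf.differentiable (by simp)
  have h1 : ∀ y i, pdP (fun y => g (f y)) y i = g' (f y) * pdP f y i := fun y i => by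
    have := (hg (f y)).comp_hasFDerivAt y (hd y).hasFDerivAt
    simp only [pdP]
    rw [show (fun y => g (f y)) = g ∘ f from rfl, this.fderiv]
    simp
  have h2 : ∀ i, fderiv ℝ (fun y => pdP (fun y => g (f y)) y i) x (dirP i)
      = g'' (f x) * (pdP f x i) ^ 2 + g' (f x) * fderiv ℝ (fun y => pdP f y i) x (dirP i) := by
    intro i
    simp only [h1]
    have e1 := (hg' (f x)).comp_hasFDerivAt x (hd x).hasFDerivAt
    have e2 : DifferentiableAt ℝ (fun y => pdP f y i) x :=
      (((hf.fderiv_right (m := 1) (by norm_num)).clm_apply contDiff_const).differentiable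
        (by simp)) x
    have e3 := e1.mul e2.hasFDerivAt
    rw [show (fun y => g' (f y) * pdP f y i) = (g' ∘ f) * (fun y => pdP f y i) from rfl, e3.fderiv]
    simp only [Function.comp_apply, add_apply, smul_apply,
      smul_eq_mul, pdP]
    ring
  simp only [ouP, laplP, h2]
  simp only [h1, Finset.sum_add_distrib, ← Finset.mul_sum]
  have h3 : ∑ i, x.2 i * (g' (f x) * pdP f x i) = g' (f x) * ∑ i, x.2 i * pdP f x i := by
    rw [Finset.mul_sum]
    exact Finset.sum_congr rfl fun i _ => by ring
  rw [h3]
  ring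

/-- Smooth truncation of small values, at level `1 / (k + 1)`. -/
def truncSmall (k : ℕ) (y : ℝ) : ℝ := (k + 1 : ℝ)⁻¹ * smoothRamp ((k + 1) * y)

lemma isTestFn_truncSmall_comp {f : Phase d → ℝ} (hf : ContDiff ℝ (⊤ : ℕ∞) f)
    (h0 : Tendsto f (cocompact _) (𝓝 0)) (k : ℕ) : IsTestFn fun x => truncSmall k (f x) := by
  refine ⟨contDiff_const.mul (contDiff_smoothRamp.comp (contDiff_const.mul hf)), ?_⟩
  have hk : (0 : ℝ) < (k + 1 : ℝ)⁻¹ := by positivity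
  obtain ⟨K, hK, hKs⟩ := mem_cocompact.1 (h0.eventually (gt_mem_nhds hk))
  refine HasCompactSupport.intro hK fun x hx => ?_
  have h1 : f x < (k + 1 : ℝ)⁻¹ := hKs hx
  have h2 : ((k : ℝ) + 1) * f x ≤ 1 := by
    have := mul_lt_mul_of_pos_left h1 (a := (k + 1 : ℝ)) (by positivity)
    rw [mul_inv_cancel₀ (by positivity)] at this
    exact this.le
  rw [truncSmall, smoothRamp_of_le_one h2, mul_zero]

lemma integral_ouP_eq_zero_of_truncSmall {m : ℝ} {f : Phase d → ℝ} (hf : ContDiff ℝ 2 f)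
    (hpos : ∀ x, 0 < f x) {M : ℝ} (hM : ∀ x, |ouP m f x| ≤ M)
    (hM' : ∀ x, ∑ i, (pdP f x i) ^ 2 ≤ M * f x) (ν : Measure (Phase d)) [IsProbabilityMeasure ν]
    (hm : ∀ k, Measurable (ouP m fun x => truncSmall k (f x)))
    (h : ∀ k, ∫ x, ouP m (fun x => truncSmall k (f x)) x ∂ν = 0) :
    ∫ x, ouP m f x ∂ν = 0 := by
  obtain ⟨K, hK⟩ := exists_bound_mul_deriv_smoothTransition
  have hform : ∀ k x, ouP m (fun x => truncSmall k (f x)) x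
      = Real.smoothTransition ((k + 1) * f x - 1) * ouP m f x
        + (k + 1) * deriv Real.smoothTransition ((k + 1) * f x - 1) * ∑ i, (pdP f x i) ^ 2 := by
    intro k x
    refine ouP_comp (g' := fun y => Real.smoothTransition ((k + 1) * y - 1))
      (g'' := fun y => (k + 1) * deriv Real.smoothTransition ((k + 1) * y - 1)) hf
      (fun y => ?_) (fun y => ?_) x
    · have h1 : HasDerivAt (fun y : ℝ => ((k : ℝ) + 1) * y) (k + 1) y := by
        simpa using (hasDerivAt_id y).const_mul ((k : ℝ) + 1)
      have h2 := ((hasDerivAt_smoothRamp (((k : ℝ) + 1) * y)).comp y h1).const_mul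
        ((k + 1 : ℝ)⁻¹)
      have h3 : (k + 1 : ℝ) ≠ 0 := by positivity
      exact HasDerivAt.congr_deriv h2 (by field_simp)
    · have h1 : HasDerivAt (fun y : ℝ => ((k : ℝ) + 1) * y - 1) (k + 1) y := by
        simpa using ((hasDerivAt_id y).const_mul ((k : ℝ) + 1)).sub_const 1
      have h0 : HasDerivAt Real.smoothTransition
          (deriv Real.smoothTransition (((k : ℝ) + 1) * y - 1)) (((k : ℝ) + 1) * y - 1) :=
        ((Real.smoothTransition.contDiff (n := 1)).differentiable (by simp) _).hasDerivAt
      have h2 := h0.comp y h1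
      exact HasDerivAt.congr_deriv h2 (by ring)
  have hK0 : 0 ≤ K := (abs_nonneg _).trans (hK 0)
  have hlim : Tendsto (fun k : ℕ => ∫ x, ouP m (fun x => truncSmall k (f x)) x ∂ν) atTop
      (𝓝 (∫ x, ouP m f x ∂ν)) := by
    refine tendsto_integral_of_dominated_convergence (fun _ => M + K * M)
      (fun k => (hm k).aestronglyMeasurable) (integrable_const _) (fun k => ae_of_all _ fun x => ?_)
      (ae_of_all _ fun x => ?_)
    · rw [hform, Real.norm_eq_abs]
      refine (abs_add_le _ _).trans (add_le_add ?_ ?_)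
      · rw [abs_mul, abs_of_nonneg (Real.smoothTransition.nonneg _)]
        exact (mul_le_of_le_one_left (abs_nonneg _) (Real.smoothTransition.le_one _)).trans (hM x)
      · have hs : 0 ≤ ∑ i, (pdP f x i) ^ 2 := Finset.sum_nonneg fun i _ => sq_nonneg _
        have h1 := hK ((k + 1) * f x)
        rw [abs_mul, abs_of_nonneg hs]
        have h2 := mul_le_mul_of_nonneg_left (hM' x)
          (abs_nonneg ((k + 1) * deriv Real.smoothTransition ((k + 1) * f x - 1)))
        refine h2.trans ?_
        have hM0 : 0 ≤ M := (abs_nonneg _).trans (hM x)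
        have h3 := mul_le_mul_of_nonneg_right h1 hM0
        refine le_trans (le_of_eq ?_) h3
        rw [abs_mul, abs_mul, abs_mul, abs_of_pos (hpos x)]
        ring
    · refine tendsto_const_nhds.congr' ?_
      have h1 : Tendsto (fun k : ℕ => ((k : ℝ) + 1) * f x) atTop atTop :=
        (tendsto_atTop_add_const_right _ 1 tendsto_natCast_atTop_atTop).atTop_mul_const (hpos x)
      filter_upwards [h1.eventually_gt_atTop 2] with k hk
      rw [hform, Real.smoothTransition.one_of_one_le (by linarith),
        deriv_smoothTransition_eq_zero (Or.inr (by linarith))]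
      ring
  exact tendsto_nhds_unique hlim (by simp [h])

end Truncation

section Gaussian

variable {d : ℕ}

/-- Unnormalized Gaussians on phase space, isotropic in `q` and in `p`. -/
def gaussExp (β α : ℝ) (b a : Fin d → ℝ) (x : Phase d) : ℝ :=
  Real.exp ((∑ i, (b i * x.1 i - β * x.1 i ^ 2)) + ∑ i, (a i * x.2 i - α * x.2 i ^ 2))

lemma contDiff_gaussExp (β α : ℝ) (b a : Fin d → ℝ) {n : WithTop ℕ∞} :
    ContDiff ℝ n (gaussExp β α b a) := by
  unfold gaussExp
  refine Real.contDiff_exp.comp (ContDiff.add ?_ ?_)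
  · refine ContDiff.sum fun i _ => ?_
    have h : ContDiff ℝ n fun x : Phase d => x.1 i := (contDiff_apply ℝ ℝ i).comp contDiff_fst
    exact (contDiff_const.mul h).sub (contDiff_const.mul (h.pow 2))
  · refine ContDiff.sum fun i _ => ?_
    have h : ContDiff ℝ n fun x : Phase d => x.2 i := (contDiff_apply ℝ ℝ i).comp contDiff_snd
    exact (contDiff_const.mul h).sub (contDiff_const.mul (h.pow 2))

lemma gaussExp_pos (β α : ℝ) (b a : Fin d → ℝ) (x : Phase d) : 0 < gaussExp β α b a x :=
  Real.exp_pos _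

lemma pdP_gaussExp (β α : ℝ) (b a : Fin d → ℝ) (x : Phase d) (i : Fin d) :
    pdP (gaussExp β α b a) x i = (a i - 2 * α * x.2 i) * gaussExp β α b a x := by
  have hl : HasDerivAt (fun s : ℝ => gaussExp β α b a (x + s • dirP i))
      ((a i - 2 * α * x.2 i) * gaussExp β α b a x) 0 := by
    have h1 : ∀ j, HasDerivAt (fun s : ℝ => (x + s • dirP i).2 j)
        ((Pi.single i 1 : Fin d → ℝ) j) 0 := fun j => by
      have := ((hasDerivAt_id (0 : ℝ)).mul_const ((Pi.single i 1 : Fin d → ℝ) j)).const_add (x.2 j)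
      simpa [dirP] using this
    have h2 : HasDerivAt (fun s : ℝ => (∑ j, (b j * x.1 j - β * x.1 j ^ 2)) +
        ∑ j, (a j * (x + s • dirP i).2 j - α * (x + s • dirP i).2 j ^ 2))
        (∑ j, (a j - 2 * α * x.2 j) * (Pi.single i 1 : Fin d → ℝ) j) 0 := by
      refine HasDerivAt.const_add _ (HasDerivAt.fun_sum fun j _ => ?_)
      refine (((h1 j).const_mul (a j)).sub (((h1 j).pow 2).const_mul α)).congr_deriv ?_
      simp
      ring
    have h3 := h2.exp
    simp only [zero_smul, add_zero] at h3
    have h4 : (fun s : ℝ => gaussExp β α b a (x + s • dirP i)) = fun s : ℝ =>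
        Real.exp ((∑ j, (b j * x.1 j - β * x.1 j ^ 2)) +
        ∑ j, (a j * (x + s • dirP i).2 j - α * (x + s • dirP i).2 j ^ 2)) := by
      funext s
      simp [gaussExp, dirP]
    rw [h4]
    exact h3.congr_deriv (by simp [gaussExp, Pi.single_apply, mul_comm])
  have hd : DifferentiableAt ℝ (gaussExp β α b a) x :=
    (contDiff_gaussExp β α b a (n := 1)).differentiable (by simp) x
  have := hd.lineDeriv_eq_fderiv (v := dirP i)
  rw [pdP, ← this]
  exact hl.deriv

/-- The factor by which the Ornstein–Uhlenbeck operator multiplies `gaussExp β α b a`. -/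
def ouFactor (m α : ℝ) (a p : Fin d → ℝ) : ℝ :=
  ∑ i, ((a i - 2 * α * p i) ^ 2 - 2 * α - 1 / m * (p i * (a i - 2 * α * p i)))

lemma ouP_gaussExp (m β α : ℝ) (b a : Fin d → ℝ) (x : Phase d) :
    ouP m (gaussExp β α b a) x = ouFactor m α a x.2 * gaussExp β α b a x := by
  have h : ∀ i, fderiv ℝ (fun y => pdP (gaussExp β α b a) y i) x (dirP i)
      = ((a i - 2 * α * x.2 i) ^ 2 - 2 * α) * gaussExp β α b a x := fun i => by
    have hd : HasFDerivAt (gaussExp β α b a) (fderiv ℝ (gaussExp β α b a) x) x :=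
      ((contDiff_gaussExp β α b a (n := 1)).differentiable (by simp) x).hasFDerivAt
    have hp : HasFDerivAt (fun y : Phase d => a i - 2 * α * y.2 i)
        (-((2 * α) • (ContinuousLinearMap.proj (R := ℝ) (φ := fun _ : Fin d => ℝ) i).comp
          (ContinuousLinearMap.snd ℝ (Fin d → ℝ) (Fin d → ℝ)))) x :=
      (((ContinuousLinearMap.proj (R := ℝ) (φ := fun _ : Fin d => ℝ) i).comp
          (ContinuousLinearMap.snd ℝ (Fin d → ℝ) (Fin d → ℝ))).hasFDerivAt.const_mul
            (2 * α)).const_sub (a i)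
    have hm := hp.mul hd
    have e := pdP_gaussExp β α b a x i
    simp only [pdP] at e
    simp only [pdP_gaussExp]
    rw [show (fun y => (a i - 2 * α * y.2 i) * gaussExp β α b a y)
      = (fun y : Phase d => a i - 2 * α * y.2 i) * gaussExp β α b a from rfl, hm.fderiv]
    simp [dirP]
    rw [show fderiv ℝ (gaussExp β α b a) x (0, Pi.single i 1) = _ from e]
    ring
  simp only [ouP, laplP, h]
  simp only [pdP_gaussExp, ouFactor]
  rw [Finset.mul_sum, Finset.sum_mul, ← Finset.sum_sub_distrib]
  exact Finset.sum_congr rfl fun i _ => by ring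

lemma linear_sub_quadratic_le {α₀ α a W p : ℝ} (h0 : 0 < α₀) (h : α₀ ≤ α) (ha : |a| ≤ W) :
    a * p - α * p ^ 2 ≤ W ^ 2 / (2 * α₀) - α₀ / 2 * p ^ 2 := by
  have h1 : a * p ≤ W * |p| :=
    (le_abs_self _).trans ((abs_mul a p).le.trans (mul_le_mul_of_nonneg_right ha (abs_nonneg _)))
  have h2 : α₀ * p ^ 2 ≤ α * p ^ 2 := mul_le_mul_of_nonneg_right h (sq_nonneg _)
  have h3 : W * |p| ≤ W ^ 2 / (2 * α₀) + α₀ / 2 * p ^ 2 := by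
    have : W ^ 2 / (2 * α₀) + α₀ / 2 * p ^ 2 - W * |p| = (W - α₀ * |p|) ^ 2 / (2 * α₀) := by
      rw [← sq_abs p]
      field_simp
      ring
    have h4 : 0 ≤ (W - α₀ * |p|) ^ 2 / (2 * α₀) := by positivity
    linarith
  linarith

lemma gaussExp_le {β α₀ α W : ℝ} {b a : Fin d → ℝ} (hβ : 0 < β) (h0 : 0 < α₀) (h : α₀ ≤ α)
    (ha : ∀ i, |a i| ≤ W) (x : Phase d) :
    gaussExp β α b a x ≤ Real.exp ((∑ i, |b i| ^ 2 / (2 * β)) + d * (W ^ 2 / (2 * α₀))) *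
      Real.exp (-(β / 2 * ∑ i, x.1 i ^ 2) - α₀ / 2 * ∑ i, x.2 i ^ 2) := by
  rw [← Real.exp_add, gaussExp, Real.exp_le_exp]
  have h1 := Finset.sum_le_sum fun i (_ : i ∈ Finset.univ) =>
    linear_sub_quadratic_le (p := x.1 i) hβ le_rfl (le_refl |b i|)
  have h2 := Finset.sum_le_sum fun i (_ : i ∈ Finset.univ) =>
    linear_sub_quadratic_le (p := x.2 i) h0 h (ha i)
  simp only [Finset.sum_sub_distrib, ← Finset.mul_sum, Finset.sum_const, Finset.card_univ,
    Fintype.card_fin, nsmul_eq_mul] at h1 h2 ⊢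
  linarith

lemma exists_bound_mul_gaussExp {β α₀ : ℝ} (b : Fin d → ℝ) (hβ : 0 < β) (h0 : 0 < α₀)
    (W K : ℝ) (hK : 0 ≤ K) : ∃ M, ∀ α, α₀ ≤ α → ∀ a : Fin d → ℝ, (∀ i, |a i| ≤ W) →
      ∀ x : Phase d, K * (1 + ∑ i, x.2 i ^ 2) * gaussExp β α b a x ≤ M := by
  refine ⟨K * ((1 + 2 / α₀) *
    Real.exp ((∑ i, |b i| ^ 2 / (2 * β)) + d * (W ^ 2 / (2 * α₀)))), fun α hα a ha x => ?_⟩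
  have h1 := gaussExp_le (b := b) hβ h0 hα ha x
  set R := Real.exp ((∑ i, |b i| ^ 2 / (2 * β)) + d * (W ^ 2 / (2 * α₀)))
  set s := ∑ i, x.2 i ^ 2
  have hs : 0 ≤ s := Finset.sum_nonneg fun i _ => sq_nonneg _
  have hq : 0 ≤ ∑ i, x.1 i ^ 2 := Finset.sum_nonneg fun i _ => sq_nonneg _
  have h2 : (1 + s) * Real.exp (-(β / 2 * ∑ i, x.1 i ^ 2) - α₀ / 2 * s) ≤ 1 + 2 / α₀ := by
    have e1 : Real.exp (-(β / 2 * ∑ i, x.1 i ^ 2) - α₀ / 2 * s) ≤ Real.exp (-(α₀ / 2 * s)) := by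
      rw [Real.exp_le_exp]
      have : 0 ≤ β / 2 * ∑ i, x.1 i ^ 2 := by positivity
      linarith
    have e2 : 1 + s ≤ (1 + 2 / α₀) * Real.exp (α₀ / 2 * s) := by
      have e3 := Real.add_one_le_exp (α₀ / 2 * s)
      have e4 := mul_le_mul_of_nonneg_left e3 (a := 1 + 2 / α₀) (by positivity)
      have e5 : (1 + 2 / α₀) * (α₀ / 2 * s + 1) = 1 + s + 2 / α₀ + α₀ / 2 * s := by
        field_simp
        ring
      have e6 : 0 ≤ 2 / α₀ + α₀ / 2 * s := by positivity
      linarith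
    calc _ ≤ ((1 + 2 / α₀) * Real.exp (α₀ / 2 * s)) * Real.exp (-(α₀ / 2 * s)) :=
          mul_le_mul e2 e1 (Real.exp_pos _).le (by positivity)
      _ = 1 + 2 / α₀ := by rw [mul_assoc, ← Real.exp_add]; simp
  have hR : 0 < R := Real.exp_pos _
  calc K * (1 + s) * gaussExp β α b a x
      ≤ K * (1 + s) * (R * Real.exp (-(β / 2 * ∑ i, x.1 i ^ 2) - α₀ / 2 * s)) :=
        mul_le_mul_of_nonneg_left h1 (by positivity)
    _ = K * (((1 + s) * Real.exp (-(β / 2 * ∑ i, x.1 i ^ 2) - α₀ / 2 * s)) * R) := by ring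
    _ ≤ _ := mul_le_mul_of_nonneg_left (mul_le_mul_of_nonneg_right h2 hR.le) hK

lemma tendsto_gaussExp_cocompact {β α : ℝ} (hβ : 0 < β) (hα : 0 < α) (b a : Fin d → ℝ) :
    Tendsto (gaussExp β α b a) (cocompact _) (𝓝 0) := by
  obtain ⟨W, hW⟩ : ∃ W, ∀ i, |a i| ≤ W :=
    ⟨∑ i, |a i|, fun i => Finset.single_le_sum (f := fun i => |a i|) (fun _ _ => abs_nonneg _)
      (Finset.mem_univ i)⟩
  have hle := gaussExp_le (b := b) hβ hα le_rfl hW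
  set R := Real.exp ((∑ i, |b i| ^ 2 / (2 * β)) + d * (W ^ 2 / (2 * α)))
  set c := min (β / 2) (α / 2) with hc
  have hc0 : 0 < c := by positivity
  have hle' : ∀ x : Phase d, gaussExp β α b a x ≤ R * Real.exp (-(c * (‖x‖ - 1))) := fun x => by
    refine (hle x).trans (mul_le_mul_of_nonneg_left (Real.exp_le_exp.2 ?_) (Real.exp_pos _).le)
    have hS1 : 0 ≤ ∑ i, x.1 i ^ 2 := Finset.sum_nonneg fun i _ => sq_nonneg _
    have hS2 : 0 ≤ ∑ i, x.2 i ^ 2 := Finset.sum_nonneg fun i _ => sq_nonneg _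
    have hn : ‖x‖ ≤ 1 + (∑ i, x.1 i ^ 2 + ∑ i, x.2 i ^ 2) := by
      have key : ∀ y : Fin d → ℝ, ‖y‖ ≤ 1 + ∑ i, y i ^ 2 := fun y => by
        refine (pi_norm_le_iff_of_nonneg (by positivity)).2 fun i => ?_
        have h1 : y i ^ 2 ≤ ∑ i, y i ^ 2 :=
          Finset.single_le_sum (f := fun i => y i ^ 2) (fun _ _ => sq_nonneg _) (Finset.mem_univ i)
        rw [Real.norm_eq_abs]
        have h2 := sq_abs (y i)
        nlinarith [sq_nonneg (|y i| - 1), abs_nonneg (y i)]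
      rw [Prod.norm_def]
      exact max_le ((key x.1).trans (by linarith)) ((key x.2).trans (by linarith))
    have h1 : c * ∑ i, x.1 i ^ 2 ≤ β / 2 * ∑ i, x.1 i ^ 2 :=
      mul_le_mul_of_nonneg_right (min_le_left _ _) hS1
    have h2 : c * ∑ i, x.2 i ^ 2 ≤ α / 2 * ∑ i, x.2 i ^ 2 :=
      mul_le_mul_of_nonneg_right (min_le_right _ _) hS2
    have h3 := mul_le_mul_of_nonneg_left hn hc0.le
    linarith
  have hz : Tendsto (fun x : Phase d => R * Real.exp (-(c * (‖x‖ - 1)))) (cocompact _) (𝓝 0) := by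
    have h1 : Tendsto (fun x : Phase d => c * (‖x‖ - 1)) (cocompact _) atTop :=
      (tendsto_atTop_add_const_right _ (-1) (tendsto_norm_cocompact_atTop)).const_mul_atTop hc0
    simpa using (Real.tendsto_exp_neg_atTop_nhds_zero.comp h1).const_mul R
  exact tendsto_of_tendsto_of_tendsto_of_le_of_le tendsto_const_nhds hz
    (fun x => (gaussExp_pos _ _ _ _ x).le) hle'

lemma abs_sub_sq_add_le {m α α₁ W a p : ℝ} (hm : 0 < m) (h0 : 0 ≤ α) (h : α ≤ α₁)
    (ha : |a| ≤ W) :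
    (a - 2 * α * p) ^ 2 + 2 * α + 1 / m * |p * (a - 2 * α * p)| ≤
      (2 * (W + 2 * α₁) ^ 2 + 2 * α₁ + 1 / m * (2 * (W + 2 * α₁))) * (1 + p ^ 2) := by
  set B := W + 2 * α₁ with hB
  have hW : 0 ≤ W := (abs_nonneg _).trans ha
  have hB0 : 0 ≤ B := by linarith
  have hv := abs_nonneg p
  have h1 : |a - 2 * α * p| ≤ B * (1 + |p|) := by
    refine (abs_sub _ _).trans ?_
    rw [abs_mul, abs_of_nonneg (by linarith : 0 ≤ 2 * α)]
    nlinarith [mul_le_mul_of_nonneg_right h hv, mul_nonneg hW hv, h0.trans h]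
  have h2 : (1 + |p|) ^ 2 ≤ 2 * (1 + p ^ 2) := by
    rw [← sq_abs p]
    nlinarith [sq_nonneg (|p| - 1)]
  have h3 : (a - 2 * α * p) ^ 2 ≤ 2 * B ^ 2 * (1 + p ^ 2) := by
    rw [← sq_abs]
    calc _ ≤ (B * (1 + |p|)) ^ 2 := pow_le_pow_left₀ (abs_nonneg _) h1 2
      _ = B ^ 2 * (1 + |p|) ^ 2 := by ring
      _ ≤ B ^ 2 * (2 * (1 + p ^ 2)) := mul_le_mul_of_nonneg_left h2 (sq_nonneg _)
      _ = _ := by ring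
  have h4 : |p * (a - 2 * α * p)| ≤ 2 * B * (1 + p ^ 2) := by
    rw [abs_mul]
    calc _ ≤ |p| * (B * (1 + |p|)) := mul_le_mul_of_nonneg_left h1 hv
      _ ≤ (1 + |p|) * (B * (1 + |p|)) := by
        refine mul_le_mul_of_nonneg_right (by linarith) (by positivity)
      _ = B * (1 + |p|) ^ 2 := by ring
      _ ≤ B * (2 * (1 + p ^ 2)) := mul_le_mul_of_nonneg_left h2 hB0
      _ = _ := by ring
  have h5 : 1 / m * |p * (a - 2 * α * p)| ≤ 1 / m * (2 * B * (1 + p ^ 2)) :=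
    mul_le_mul_of_nonneg_left h4 (by positivity)
  have h6 : 2 * α ≤ 2 * α₁ * (1 + p ^ 2) := by
    nlinarith [mul_nonneg (h0.trans h) (sq_nonneg p)]
  linarith

lemma sum_quadratic_le {c : ℝ} (hc : 0 ≤ c) {u p : Fin d → ℝ} (hu : ∀ i, u i ≤ c * (1 + p i ^ 2)) :
    ∑ i, u i ≤ c * (d + 1) * (1 + ∑ i, p i ^ 2) := by
  refine (Finset.sum_le_sum fun i _ => hu i).trans ?_
  rw [← Finset.mul_sum, Finset.sum_add_distrib, mul_assoc]
  refine mul_le_mul_of_nonneg_left ?_ hc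
  have hs : 0 ≤ ∑ i, p i ^ 2 := Finset.sum_nonneg fun i _ => sq_nonneg _
  simp
  nlinarith [mul_nonneg (Nat.cast_nonneg (α := ℝ) d) hs]

/-- Uniform bounds for a family of Gaussians with parameters in a bounded range. -/
lemma exists_bound_gaussExp {m β α₀ : ℝ} (b : Fin d → ℝ) (hm : 0 < m) (hβ : 0 < β) (h0 : 0 < α₀)
    (α₁ : ℝ) {W : ℝ} (hW : 0 ≤ W) : ∃ M, ∀ α, α₀ ≤ α → α ≤ α₁ → ∀ a : Fin d → ℝ,
      (∀ i, |a i| ≤ W) → ∀ x : Phase d, |ouP m (gaussExp β α b a) x| ≤ M ∧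
        ∑ i, (pdP (gaussExp β α b a) x i) ^ 2 ≤ M * gaussExp β α b a x := by
  set c := 2 * (W + 2 * |α₁|) ^ 2 + 2 * |α₁| + 1 / m * (2 * (W + 2 * |α₁|)) with hc
  have hc0 : 0 ≤ c := by positivity
  obtain ⟨M, hM⟩ := exists_bound_mul_gaussExp b hβ h0 W (c * (d + 1)) (by positivity)
  refine ⟨M, fun α hα hα' a ha x => ?_⟩
  have hM' := hM α hα a ha x
  have hg := gaussExp_pos β α b a x
  have hα0 : 0 ≤ α := h0.le.trans hα
  have hterm := fun i => abs_sub_sq_add_le (p := x.2 i) hm hα0 (hα'.trans (le_abs_self _)) (ha i)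
  constructor
  · rw [ouP_gaussExp, abs_mul, abs_of_pos hg]
    refine (mul_le_mul_of_nonneg_right ?_ hg.le).trans hM'
    refine (Finset.abs_sum_le_sum_abs _ _).trans (sum_quadratic_le hc0 fun i => ?_)
    refine le_trans ?_ (hterm i)
    refine (abs_sub _ _).trans (add_le_add ((abs_sub _ _).trans (le_of_eq ?_)) (le_of_eq ?_))
    · rw [abs_of_nonneg (sq_nonneg _), abs_of_nonneg (by positivity)]
    · rw [abs_mul, abs_of_pos (by positivity)]
  · simp only [pdP_gaussExp, mul_pow, ← Finset.sum_mul]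
    rw [sq (gaussExp β α b a x), ← mul_assoc]
    refine mul_le_mul_of_nonneg_right ((mul_le_mul_of_nonneg_right ?_ hg.le).trans hM') hg.le
    refine sum_quadratic_le hc0 fun i => le_trans ?_ (hterm i)
    have : 0 ≤ 1 / m * |x.2 i * (a i - 2 * α * x.2 i)| := by positivity
    linarith

end Gaussian

section Mehler

/-- The denominator in the Mehler flow of Gaussian functions. -/
def mehlerDen (m τ r : ℝ) : ℝ := τ + m - m * r ^ 2

/-- Exponent, in one momentum coordinate, of the image of `exp (a p - p² / (2 τ))` under the
Ornstein–Uhlenbeck semigroup at time `- m log r`. -/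
def mehlerExp (m τ r a p : ℝ) : ℝ :=
  -(1 / 2) * Real.log (mehlerDen m τ r) + 1 / 2 * Real.log τ
    + (τ / 2 - τ ^ 2 / 2 * (mehlerDen m τ r)⁻¹) * a ^ 2
    + (r * τ * (mehlerDen m τ r)⁻¹ * a * p - r ^ 2 / 2 * (mehlerDen m τ r)⁻¹ * p ^ 2)

lemma le_mehlerDen {m τ r : ℝ} (hm : 0 < m) (hr : r ∈ Icc (0 : ℝ) 1) : τ ≤ mehlerDen m τ r := by
  have : r ^ 2 ≤ 1 := pow_le_one₀ hr.1 hr.2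
  unfold mehlerDen
  nlinarith

lemma mehlerDen_le {m τ : ℝ} (hm : 0 < m) (r : ℝ) : mehlerDen m τ r ≤ τ + m := by
  unfold mehlerDen
  nlinarith [sq_nonneg r]

lemma hasDerivAt_mehlerExp {m τ r : ℝ} (hD : 0 < mehlerDen m τ r) (a p : ℝ) :
    HasDerivAt (fun r => mehlerExp m τ r a p)
      (m * r * (mehlerDen m τ r)⁻¹ - τ ^ 2 * m * r * (mehlerDen m τ r)⁻¹ ^ 2 * a ^ 2
        + (τ * (mehlerDen m τ r)⁻¹ + 2 * m * τ * r ^ 2 * (mehlerDen m τ r)⁻¹ ^ 2) * a * p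
        - (r * (mehlerDen m τ r)⁻¹ + m * r ^ 3 * (mehlerDen m τ r)⁻¹ ^ 2) * p ^ 2) r := by
  have h1 : HasDerivAt (mehlerDen m τ) (-(2 * m * r)) r := by
    have := (((hasDerivAt_id r).pow 2).const_mul m).const_sub (τ + m)
    refine HasDerivAt.congr_deriv this ?_
    simp
    ring
  have h2 := h1.log hD.ne'
  have h3 : HasDerivAt (fun r => (mehlerDen m τ r)⁻¹)
      (2 * m * r * (mehlerDen m τ r)⁻¹ ^ 2) r :=
    (h1.fun_inv hD.ne').congr_deriv (by rw [neg_neg, inv_pow]; rfl)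
  have h4 := (((h2.const_mul (-(1 / 2))).add_const (1 / 2 * Real.log τ)).add
    (((h3.const_mul (τ ^ 2 / 2)).const_sub (τ / 2)).mul_const (a ^ 2))).add
    ((((((hasDerivAt_id r).mul_const τ).mul h3).mul_const a).mul_const p).sub
      (((((hasDerivAt_id r).pow 2).div_const 2).mul h3).mul_const (p ^ 2)))
  refine HasDerivAt.congr_deriv h4 ?_
  simp only [id, Pi.pow_apply]
  field_simp
  ring

lemma mehlerExp_deriv_eq {m τ r D : ℝ} (hm : 0 < m) (hr : 0 < r) (hD : 0 < D) (a p : ℝ) :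
    m * r * D⁻¹ - τ ^ 2 * m * r * D⁻¹ ^ 2 * a ^ 2
        + (τ * D⁻¹ + 2 * m * τ * r ^ 2 * D⁻¹ ^ 2) * a * p
        - (r * D⁻¹ + m * r ^ 3 * D⁻¹ ^ 2) * p ^ 2
      = -(m / r) * ((r * τ * D⁻¹ * a - 2 * (r ^ 2 / 2 * D⁻¹) * p) ^ 2 - 2 * (r ^ 2 / 2 * D⁻¹)
        - 1 / m * (p * (r * τ * D⁻¹ * a - 2 * (r ^ 2 / 2 * D⁻¹) * p))) := by
  field_simp
  ring

lemma mehlerExp_le {m τ r : ℝ} (hm : 0 < m) (hτ : 0 < τ) (hr : r ∈ Icc (0 : ℝ) 1) (a p : ℝ) :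
    mehlerExp m τ r a p ≤ τ / 2 * a ^ 2 := by
  have h1 := le_mehlerDen (τ := τ) hm hr
  have h2 := Real.log_le_log hτ h1
  have hD : 0 < mehlerDen m τ r := hτ.trans_le h1
  have h3 : 0 ≤ (r * p - τ * a) ^ 2 * (mehlerDen m τ r)⁻¹ := by positivity
  unfold mehlerExp
  linarith

variable {d : ℕ}

/-- The Mehler flow of a Gaussian on phase space. -/
def mehlerFlow (m τ β : ℝ) (b a : Fin d → ℝ) (r : ℝ) (x : Phase d) : ℝ :=
  Real.exp ((∑ i, (b i * x.1 i - β * x.1 i ^ 2)) + ∑ i, mehlerExp m τ r (a i) (x.2 i))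

/-- The Gaussian which is proportional to the Mehler flow at parameter `r`. -/
def mehlerGauss (m τ β : ℝ) (b a : Fin d → ℝ) (r : ℝ) : Phase d → ℝ :=
  gaussExp β (r ^ 2 / 2 * (mehlerDen m τ r)⁻¹) b fun i => r * τ * (mehlerDen m τ r)⁻¹ * a i

/-- The constant of proportionality between `mehlerFlow` and `mehlerGauss`. -/
def mehlerConst (m τ : ℝ) (a : Fin d → ℝ) (r : ℝ) : ℝ :=
  Real.exp (∑ i, (-(1 / 2) * Real.log (mehlerDen m τ r) + 1 / 2 * Real.log τ
    + (τ / 2 - τ ^ 2 / 2 * (mehlerDen m τ r)⁻¹) * a i ^ 2))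

lemma mehlerFlow_eq (m τ β : ℝ) (b a : Fin d → ℝ) (r : ℝ) (x : Phase d) :
    mehlerFlow m τ β b a r x = mehlerConst m τ a r * mehlerGauss m τ β b a r x := by
  unfold mehlerFlow mehlerConst mehlerGauss gaussExp mehlerExp
  rw [← Real.exp_add, Finset.sum_add_distrib]
  congr 1
  ring

lemma mehlerFlow_one {m τ : ℝ} (hτ : 0 < τ) (β : ℝ) (b a : Fin d → ℝ) (x : Phase d) :
    mehlerFlow m τ β b a 1 x = gaussExp β (1 / (2 * τ)) b a x := by
  have h : mehlerDen m τ 1 = τ := by simp [mehlerDen]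
  unfold mehlerFlow gaussExp mehlerExp
  rw [h]
  congr 2
  refine Finset.sum_congr rfl fun i _ => ?_
  field_simp
  ring

lemma mehlerFlow_zero (m τ β : ℝ) (b a : Fin d → ℝ) (x : Phase d) :
    mehlerFlow m τ β b a 0 x = mehlerConst m τ a 0 * gaussExp β 0 b 0 x := by
  rw [mehlerFlow_eq]
  simp [mehlerGauss, gaussExp]

lemma mehlerFlow_pos (m τ β : ℝ) (b a : Fin d → ℝ) (r : ℝ) (x : Phase d) :
    0 < mehlerFlow m τ β b a r x := Real.exp_pos _

lemma mehlerFlow_le {m τ β r : ℝ} (hm : 0 < m) (hτ : 0 < τ) (hβ : 0 < β) (b a : Fin d → ℝ)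
    (hr : r ∈ Icc (0 : ℝ) 1) (x : Phase d) : mehlerFlow m τ β b a r x ≤
      Real.exp ((∑ i, |b i| ^ 2 / (2 * β)) + ∑ i, τ / 2 * a i ^ 2) := by
  refine Real.exp_le_exp.2 (add_le_add (Finset.sum_le_sum fun i _ => ?_)
    (Finset.sum_le_sum fun i _ => mehlerExp_le hm hτ hr _ _))
  have := linear_sub_quadratic_le (p := x.1 i) hβ le_rfl (le_refl |b i|)
  have h2 : 0 ≤ β / 2 * x.1 i ^ 2 := by positivity
  linarith

lemma hasDerivAt_mehlerFlow {m τ β r : ℝ} (hm : 0 < m) (hD : 0 < mehlerDen m τ r)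
    (hr : 0 < r) (b a : Fin d → ℝ) (x : Phase d) :
    HasDerivAt (fun r => mehlerFlow m τ β b a r x)
      (-(m / r) * mehlerConst m τ a r * ouP m (mehlerGauss m τ β b a r) x) r := by
  have h1 := ((HasDerivAt.fun_sum fun i (_ : i ∈ Finset.univ) =>
    hasDerivAt_mehlerExp hD (a i) (x.2 i)).const_add (∑ i, (b i * x.1 i - β * x.1 i ^ 2))).exp
  refine HasDerivAt.congr_deriv h1 ?_
  simp only [mehlerExp_deriv_eq hm hr hD]
  rw [← Finset.mul_sum, mehlerGauss, ouP_gaussExp, ouFactor]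
  change mehlerFlow m τ β b a r x * _ = _
  rw [mehlerFlow_eq, mehlerGauss]
  ring

lemma continuousAt_mehlerFlow {m τ β r : ℝ} (hD : 0 < mehlerDen m τ r) (b a : Fin d → ℝ)
    (x : Phase d) : ContinuousAt (fun r => mehlerFlow m τ β b a r x) r :=
  ((HasDerivAt.fun_sum fun i (_ : i ∈ Finset.univ) =>
    hasDerivAt_mehlerExp hD (a i) (x.2 i)).const_add
      (∑ i, (b i * x.1 i - β * x.1 i ^ 2))).exp.continuousAt

lemma continuousAt_ouP_mehlerGauss {m τ β r : ℝ} (hD : 0 < mehlerDen m τ r) (b a : Fin d → ℝ)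
    (x : Phase d) : ContinuousAt (fun r => ouP m (mehlerGauss m τ β b a r) x) r := by
  have h1 : ContinuousAt (fun r => (mehlerDen m τ r)⁻¹) r := by
    refine ContinuousAt.inv₀ ?_ hD.ne'
    unfold mehlerDen
    fun_prop
  simp only [mehlerGauss, ouP_gaussExp, ouFactor, gaussExp]
  fun_prop

/-- Uniform bounds for the Gaussians along the Mehler flow, away from `r = 0`. -/
lemma exists_bound_mehlerGauss {m τ β δ : ℝ} (hm : 0 < m) (hτ : 0 < τ) (hβ : 0 < β) (hδ : 0 < δ)
    (b a : Fin d → ℝ) : ∃ M, ∀ r ∈ Icc δ 1, ∀ x,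
      |ouP m (mehlerGauss m τ β b a r) x| ≤ M ∧
        ∑ i, (pdP (mehlerGauss m τ β b a r) x i) ^ 2 ≤ M * mehlerGauss m τ β b a r x := by
  obtain ⟨M, hM⟩ := exists_bound_gaussExp b hm hβ
    (show 0 < δ ^ 2 / 2 * (τ + m)⁻¹ by positivity) (1 / 2 * τ⁻¹) (W := ∑ i, |a i|)
    (Finset.sum_nonneg fun _ _ => abs_nonneg _)
  refine ⟨M, fun r hr x => hM _ ?_ ?_ _ (fun i => ?_) x⟩
  all_goals
    have hr' : r ∈ Icc (0 : ℝ) 1 := ⟨hδ.le.trans hr.1, hr.2⟩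
    have h1 := le_mehlerDen (τ := τ) hm hr'
    have h2 := mehlerDen_le (τ := τ) hm r
    have hD : 0 < mehlerDen m τ r := hτ.trans_le h1
  · have : δ ^ 2 ≤ r ^ 2 := pow_le_pow_left₀ hδ.le hr.1 2
    gcongr
  · have : r ^ 2 ≤ 1 := pow_le_one₀ hr'.1 hr'.2
    gcongr
  · have h3 : τ * (mehlerDen m τ r)⁻¹ ≤ 1 := by
      rw [← div_eq_mul_inv]
      exact (div_le_one hD).2 h1
    have h4 : 0 ≤ τ * (mehlerDen m τ r)⁻¹ := by positivity
    have h5 : r * τ * (mehlerDen m τ r)⁻¹ ≤ 1 := by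
      rw [mul_assoc]
      exact mul_le_one₀ hr'.2 h4 h3
    have h6 : 0 ≤ r * τ * (mehlerDen m τ r)⁻¹ := by
      rw [mul_assoc]
      exact mul_nonneg hr'.1 h4
    rw [abs_mul, abs_of_nonneg h6]
    exact (mul_le_of_le_one_left (abs_nonneg _) h5).trans
      (Finset.single_le_sum (f := fun i => |a i|) (fun _ _ => abs_nonneg _) (Finset.mem_univ i))

lemma continuous_ouP_mehlerGauss (m τ β : ℝ) (b a : Fin d → ℝ) (r : ℝ) :
    Continuous (ouP m (mehlerGauss m τ β b a r)) := by
  have : ouP m (mehlerGauss m τ β b a r) = fun x => _ := funext fun x => ouP_gaussExp _ _ _ _ _ x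
  rw [this]
  refine Continuous.mul ?_ (contDiff_gaussExp _ _ _ _ (n := 0)).continuous
  unfold ouFactor
  fun_prop

lemma continuous_mehlerFlow (m τ β : ℝ) (b a : Fin d → ℝ) (r : ℝ) :
    Continuous (mehlerFlow m τ β b a r) := by
  unfold mehlerFlow mehlerExp
  fun_prop

lemma mehlerConst_le {m τ r : ℝ} (hm : 0 < m) (hτ : 0 < τ) (hr : r ∈ Icc (0 : ℝ) 1)
    (a : Fin d → ℝ) : mehlerConst m τ a r ≤ Real.exp (∑ i, τ / 2 * a i ^ 2) := by
  refine Real.exp_le_exp.2 (Finset.sum_le_sum fun i _ => ?_)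
  simpa [mehlerExp] using mehlerExp_le hm hτ hr (a i) 0

variable {m τ β : ℝ} (hm : 0 < m) (hτ : 0 < τ) (hβ : 0 < β) (b a : Fin d → ℝ)
  (ν : Measure (Phase d)) [IsProbabilityMeasure ν]
  (h : ∀ r : ℚ, (r : ℝ) ∈ Ioo (0 : ℝ) 1 → ∫ x, ouP m (mehlerGauss m τ β b a r) x ∂ν = 0)
include hm hτ hβ h

lemma integral_ouP_mehlerGauss_eq_zero {r : ℝ} (hr : r ∈ Ioo (0 : ℝ) 1) :
    ∫ x, ouP m (mehlerGauss m τ β b a r) x ∂ν = 0 := by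
  have hcont : ContinuousOn (fun r => ∫ x, ouP m (mehlerGauss m τ β b a r) x ∂ν) (Ioo 0 1) := by
    intro s hs
    obtain ⟨M, hM⟩ := exists_bound_mehlerGauss hm hτ hβ (half_pos hs.1) b a
    refine ContinuousAt.continuousWithinAt (continuousAt_of_dominated (bound := fun _ => M)
      (Eventually.of_forall fun s =>
        (continuous_ouP_mehlerGauss m τ β b a s).measurable.aestronglyMeasurable) ?_
      (integrable_const _) (ae_of_all _ fun x => continuousAt_ouP_mehlerGauss
        (hτ.trans_le (le_mehlerDen hm ⟨hs.1.le, hs.2.le⟩)) b a x))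
    filter_upwards [Icc_mem_nhds (half_lt_self hs.1) hs.2] with u hu
    exact ae_of_all _ fun x => (hM u hu x).1
  by_contra hne
  have ho : IsOpen (Ioo (0 : ℝ) 1 ∩
      (fun r => ∫ x, ouP m (mehlerGauss m τ β b a r) x ∂ν) ⁻¹' {0}ᶜ) :=
    hcont.isOpen_inter_preimage isOpen_Ioo isOpen_compl_singleton
  obtain ⟨q, hq⟩ := Rat.denseRange_cast.exists_mem_open ho ⟨r, hr, hne⟩
  exact hq.2 (h q hq.1)

/-- The integral of the Mehler flow is constant. -/
lemma integral_gaussExp_eq :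
    ∫ x, gaussExp β (1 / (2 * τ)) b a x ∂ν
      = mehlerConst m τ a 0 * ∫ x, gaussExp β 0 b 0 x ∂ν := by
  have hDpos : ∀ r ∈ Icc (0 : ℝ) 1, 0 < mehlerDen m τ r :=
    fun r hr => hτ.trans_le (le_mehlerDen hm hr)
  have hint : ∀ r ∈ Icc (0 : ℝ) 1, Integrable (mehlerFlow m τ β b a r) ν := fun r hr =>
    integrable_of_continuous_of_bound (continuous_mehlerFlow _ _ _ _ _ _) fun x => by
      rw [abs_of_pos (mehlerFlow_pos _ _ _ _ _ _ _)]
      exact mehlerFlow_le hm hτ hβ b a hr x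
  have hcont : ContinuousOn (fun r => ∫ x, mehlerFlow m τ β b a r x ∂ν) (Icc 0 1) := by
    refine continuousOn_of_dominated (F := fun r x => mehlerFlow m τ β b a r x)
      (bound := fun _ => Real.exp ((∑ i, |b i| ^ 2 / (2 * β)) + ∑ i, τ / 2 * a i ^ 2))
      (fun r _ => (continuous_mehlerFlow m τ β b a r).measurable.aestronglyMeasurable)
      (fun r hr => ae_of_all _ fun x => ?_) (integrable_const _)
      (ae_of_all _ fun x r hr => (continuousAt_mehlerFlow (hDpos r hr) b a x).continuousWithinAt)
    rw [Real.norm_eq_abs, abs_of_pos (mehlerFlow_pos _ _ _ _ _ _ _)]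
    exact mehlerFlow_le hm hτ hβ b a hr x
  have hder : ∀ r ∈ Ioo (0 : ℝ) 1,
      HasDerivAt (fun r => ∫ x, mehlerFlow m τ β b a r x ∂ν) 0 r := by
    intro r hr
    obtain ⟨M, hM⟩ := exists_bound_mehlerGauss hm hτ hβ (half_pos hr.1) b a
    have hs : Ioo (r / 2) 1 ∈ 𝓝 r := Ioo_mem_nhds (half_lt_self hr.1) hr.2
    have := (hasDerivAt_integral_of_dominated_loc_of_deriv_le (μ := ν)
      (F := fun r x => mehlerFlow m τ β b a r x)
      (F' := fun r x => -(m / r) * mehlerConst m τ a r * ouP m (mehlerGauss m τ β b a r) x)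
      (bound := fun _ => m / (r / 2) * Real.exp (∑ i, τ / 2 * a i ^ 2) * M) hs
      (Eventually.of_forall fun s =>
        (continuous_mehlerFlow m τ β b a s).measurable.aestronglyMeasurable)
      (hint r ⟨hr.1.le, hr.2.le⟩)
      ((continuous_ouP_mehlerGauss m τ β b a r).measurable.aestronglyMeasurable.const_mul _)
      (ae_of_all _ fun x s hs => ?_) (integrable_const _) (ae_of_all _ fun x s hs => ?_)).2
    · rw [integral_const_mul, integral_ouP_mehlerGauss_eq_zero hm hτ hβ b a ν h hr, mul_zero] at this
      exact this
    · have hr2 := hr.1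
      have hs0 : 0 < s := (half_pos hr.1).trans hs.1
      rw [Real.norm_eq_abs, abs_mul, abs_mul, abs_neg, abs_of_pos (div_pos hm hs0),
        abs_of_pos (show 0 < mehlerConst m τ a s from Real.exp_pos _)]
      have h1 := mehlerConst_le hm hτ ⟨hs0.le, hs.2.le⟩ a
      have h2 : m / s ≤ m / (r / 2) := div_le_div_of_nonneg_left hm.le (half_pos hr.1) hs.1.le
      have h3 := (hM s ⟨hs.1.le, hs.2.le⟩ x).1
      have h4 : 0 < mehlerConst m τ a s := Real.exp_pos _
      gcongr
    · have hs0 : 0 < s := (half_pos hr.1).trans hs.1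
      exact hasDerivAt_mehlerFlow hm (hDpos s ⟨hs0.le, hs.2.le⟩) hs0 b a x
  obtain ⟨c, _, hc⟩ := exists_hasDerivAt_eq_slope _ _ zero_lt_one hcont hder
  simp only [mehlerFlow_one hτ, mehlerFlow_zero, integral_const_mul] at hc
  linarith

end Mehler

section Maxwellian

lemma integral_exp_linear_sub_quadratic {c : ℝ} (hc : 0 < c) (a : ℝ) :
    ∫ p : ℝ, Real.exp (a * p - c * p ^ 2) = √(π / c) * Real.exp (a ^ 2 / (4 * c)) := by
  have h : ∀ p : ℝ, Real.exp (a * p - c * p ^ 2)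
      = Real.exp (-c * (p - a / (2 * c)) ^ 2) * Real.exp (a ^ 2 / (4 * c)) := fun p => by
    rw [← Real.exp_add]
    congr 1
    field_simp
    ring
  simp_rw [h]
  rw [integral_mul_const, integral_sub_right_eq_self (fun p : ℝ => Real.exp (-c * p ^ 2)),
    integral_gaussian]

lemma integral_exp_sum_linear_sub_quadratic {d : ℕ} {c : ℝ} (hc : 0 < c) (a : Fin d → ℝ) :
    ∫ p : Fin d → ℝ, Real.exp (∑ i, (a i * p i - c * p i ^ 2))
      = ∏ i, (√(π / c) * Real.exp (a i ^ 2 / (4 * c))) := by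
  simp_rw [Real.exp_sum, ← integral_exp_linear_sub_quadratic hc]
  exact integral_fintype_prod_volume_eq_prod (fun i (p : ℝ) => Real.exp (a i * p - c * p ^ 2))

lemma maxwell_exponent_eq {d : ℕ} (m : ℝ) (p : Fin d → ℝ) :
    -(∑ i, (p i) ^ 2) / (2 * m) = ∑ i, (0 * p i - 1 / (2 * m) * p i ^ 2) := by
  simp only [zero_mul, zero_sub, Finset.sum_neg_distrib, ← Finset.mul_sum]
  ring

lemma maxwellZ_eq {d : ℕ} {m : ℝ} (hm : 0 < m) :
    maxwellZ d m = ∏ _i : Fin d, √(π / (1 / (2 * m))) := by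
  unfold maxwellZ
  simp_rw [maxwell_exponent_eq]
  have := integral_exp_sum_linear_sub_quadratic (d := d) (c := 1 / (2 * m)) (by positivity) 0
  simpa using this

lemma maxwellZ_pos {d : ℕ} {m : ℝ} (hm : 0 < m) : 0 < maxwellZ d m := by
  rw [maxwellZ_eq hm]
  exact Finset.prod_pos fun i _ => by positivity

lemma isProbabilityMeasure_maxwellian {d : ℕ} {m : ℝ} (hm : 0 < m) :
    IsProbabilityMeasure (maxwellian d m) := by
  have hZ := maxwellZ_pos (d := d) hm
  have hi : Integrable fun p : Fin d → ℝ => Real.exp (-(∑ i, (p i) ^ 2) / (2 * m)) :=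
    Integrable.of_integral_ne_zero hZ.ne'
  refine ⟨?_⟩
  rw [maxwellian, withDensity_apply _ MeasurableSet.univ, Measure.restrict_univ,
    ← ofReal_integral_eq_lintegral_ofReal (hi.const_mul _) (ae_of_all _ fun p => by positivity),
    integral_const_mul]
  change ENNReal.ofReal ((maxwellZ d m)⁻¹ * maxwellZ d m) = 1
  rw [inv_mul_cancel₀ hZ.ne', ENNReal.ofReal_one]

lemma integral_maxwellian {d : ℕ} {m : ℝ} (hm : 0 < m) (f : (Fin d → ℝ) → ℝ) :
    ∫ p, f p ∂(maxwellian d m)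
      = (maxwellZ d m)⁻¹ * ∫ p, Real.exp (-(∑ i, (p i) ^ 2) / (2 * m)) * f p := by
  have hZ := maxwellZ_pos (d := d) hm
  rw [maxwellian, integral_withDensity_eq_integral_toReal_smul (by fun_prop)
    (ae_of_all _ fun _ => ENNReal.ofReal_lt_top), ← integral_const_mul]
  refine integral_congr_ae (ae_of_all _ fun p => ?_)
  simp only [smul_eq_mul]
  rw [ENNReal.toReal_ofReal (by positivity), mul_assoc]

lemma integral_exp_maxwellian {d : ℕ} {m τ : ℝ} (hm : 0 < m) (hτ : 0 < τ) (a : Fin d → ℝ) :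
    ∫ p, Real.exp (∑ i, (a i * p i - 1 / (2 * τ) * p i ^ 2)) ∂(maxwellian d m)
      = mehlerConst m τ a 0 := by
  have hc : 0 < 1 / (2 * m) + 1 / (2 * τ) := by positivity
  have h : ∀ p : Fin d → ℝ, Real.exp (-(∑ i, (p i) ^ 2) / (2 * m))
      * Real.exp (∑ i, (a i * p i - 1 / (2 * τ) * p i ^ 2))
      = Real.exp (∑ i, (a i * p i - (1 / (2 * m) + 1 / (2 * τ)) * p i ^ 2)) := fun p => by
    rw [maxwell_exponent_eq, ← Real.exp_add, ← Finset.sum_add_distrib]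
    congr 1
    refine Finset.sum_congr rfl fun i _ => ?_
    ring
  rw [integral_maxwellian hm]
  simp_rw [h]
  rw [integral_exp_sum_linear_sub_quadratic hc, maxwellZ_eq hm, ← Finset.prod_inv_distrib,
    ← Finset.prod_mul_distrib, mehlerConst, Real.exp_sum]
  refine Finset.prod_congr rfl fun i _ => ?_
  have h1 : mehlerDen m τ 0 = τ + m := by simp [mehlerDen]
  have h2 : (√(π / (1 / (2 * m))))⁻¹ * √(π / (1 / (2 * m) + 1 / (2 * τ)))
      = Real.exp (-(1 / 2) * Real.log (τ + m) + 1 / 2 * Real.log τ) := by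
    rw [← Real.sqrt_inv, ← Real.sqrt_mul (by positivity)]
    have h3 : (π / (1 / (2 * m)))⁻¹ * (π / (1 / (2 * m) + 1 / (2 * τ))) = τ / (τ + m) := by
      field_simp
    rw [h3, Real.sqrt_eq_rpow, Real.rpow_def_of_pos (by positivity),
      Real.log_div hτ.ne' (by positivity)]
    congr 1
    ring
  rw [← mul_assoc, h2, ← Real.exp_add, h1]
  congr 2
  field_simp
  ring

end Maxwellian

section Uniqueness

variable {d : ℕ}

lemma gaussExp_mul (β α β' α' : ℝ) (b a b' a' : Fin d → ℝ) (x : Phase d) :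
    gaussExp β α b a x * gaussExp β' α' b' a' x
      = gaussExp (β + β') (α + α') (b + b') (a + a') x := by
  unfold gaussExp
  rw [← Real.exp_add]
  congr 1
  have h : ∀ (u v : ℝ) (s t y : Fin d → ℝ), ∑ i, ((s + t) i * y i - (u + v) * y i ^ 2)
      = ∑ i, (s i * y i - u * y i ^ 2) + ∑ i, (t i * y i - v * y i ^ 2) := fun u v s t y => by
    rw [← Finset.sum_add_distrib]
    refine Finset.sum_congr rfl fun i _ => ?_
    simp only [Pi.add_apply]
    ring
  rw [h, h]
  ring

/-- A bounded continuous function which is a Gaussian with natural number parameters. -/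
def IsNatGauss (g : BoundedContinuousFunction (Phase d) ℝ) : Prop :=
  ∃ (k l : ℕ) (b a : Fin d → ℕ), 0 < k ∧ 0 < l ∧
    ∀ x, g x = gaussExp k l (fun i => b i) (fun i => a i) x

lemma IsNatGauss.mul {g h : BoundedContinuousFunction (Phase d) ℝ} (hg : IsNatGauss g)
    (hh : IsNatGauss h) : IsNatGauss (g * h) := by
  obtain ⟨k, l, b, a, hk, hl, hg⟩ := hg
  obtain ⟨k', l', b', a', _, _, hh⟩ := hh
  refine ⟨k + k', l + l', b + b', a + a', by lia, by lia, fun x => ?_⟩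
  rw [BoundedContinuousFunction.mul_apply, hg, hh, gaussExp_mul]
  push_cast
  congr 1 <;> · funext i; simp

lemma exists_isNatGauss {k l : ℕ} (hk : 0 < k) (hl : 0 < l) (b a : Fin d → ℕ) :
    ∃ g, IsNatGauss g ∧ ∀ x, g x = gaussExp k l (fun i => (b i : ℝ)) (fun i => (a i : ℝ)) x := by
  have hk' : (0 : ℝ) < k := by exact_mod_cast hk
  have hl' : (0 : ℝ) < l := by exact_mod_cast hl
  have hb : ∀ x, |gaussExp k l (fun i => (b i : ℝ)) (fun i => (a i : ℝ)) x| ≤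
      Real.exp ((∑ i, |(b i : ℝ)| ^ 2 / (2 * k)) + d * ((∑ i, |(a i : ℝ)|) ^ 2 / (2 * l))) :=
      fun x => by
    rw [abs_of_pos (gaussExp_pos _ _ _ _ _)]
    refine (gaussExp_le (W := ∑ i, |(a i : ℝ)|) hk' hl' le_rfl (fun i =>
      Finset.single_le_sum (f := fun i => |(a i : ℝ)|) (fun _ _ => abs_nonneg _)
        (Finset.mem_univ i)) x).trans (mul_le_of_le_one_right (Real.exp_pos _).le ?_)
    have h1 : 0 ≤ ∑ i, x.1 i ^ 2 := Finset.sum_nonneg fun i _ => sq_nonneg _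
    have h2 : 0 ≤ ∑ i, x.2 i ^ 2 := Finset.sum_nonneg fun i _ => sq_nonneg _
    rw [Real.exp_le_one_iff]
    nlinarith [mul_nonneg hk'.le h1, mul_nonneg hl'.le h2]
  obtain ⟨g, hg⟩ := Continuous.exists_boundedContinuousFunction
    (contDiff_gaussExp _ _ _ _ (n := 0)).continuous hb
  exact ⟨g, ⟨k, l, b, a, hk, hl, hg⟩, hg⟩

lemma exists_isNatGauss_ne {x y : Phase d} (hxy : x ≠ y) : ∃ g, IsNatGauss g ∧ g x ≠ g y := by
  by_contra! hc
  have key : ∀ b a : Fin d → ℕ,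
      (∑ i, (b i * x.1 i - x.1 i ^ 2)) + ∑ i, (a i * x.2 i - x.2 i ^ 2)
        = (∑ i, (b i * y.1 i - y.1 i ^ 2)) + ∑ i, (a i * y.2 i - y.2 i ^ 2) := fun b a => by
    obtain ⟨g, hg, hgx⟩ := exists_isNatGauss one_pos one_pos b a
    have := hc g hg
    rw [hgx, hgx] at this
    simpa [gaussExp] using Real.exp_injective this
  have h0 := key 0 0
  simp only [Finset.sum_sub_distrib] at key h0
  refine hxy (Prod.ext (funext fun i => ?_) (funext fun i => ?_))
  · have := key (Pi.single i 1) 0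
    simp [Pi.single_apply] at this h0
    linarith
  · have := key 0 (Pi.single i 1)
    simp [Pi.single_apply] at this h0
    linarith

lemma measure_ext_of_integral_isNatGauss {μ ν : Measure (Phase d)} [IsProbabilityMeasure μ]
    [IsProbabilityMeasure ν] (h : ∀ g, IsNatGauss g → ∫ x, g x ∂μ = ∫ x, g x ∂ν) : μ = ν := by
  let A : StarSubalgebra ℝ (BoundedContinuousFunction (Phase d) ℝ) :=
    { Algebra.adjoin ℝ {g | IsNatGauss g} with
      star_mem' := fun {g} hg => by
        have : star g = g := by ext x; simp
        rwa [this] }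
  have hA : ∀ g, g ∈ A ↔ g ∈ Algebra.adjoin ℝ {g : BoundedContinuousFunction (Phase d) ℝ |
      IsNatGauss g} := fun _ => Iff.rfl
  refine ext_of_forall_mem_subalgebra_integral_eq_of_pseudoEMetric_complete_countable
    (𝕜 := ℝ) (A := A) ?_ ?_
  · intro x y hxy
    obtain ⟨g, hg, hne⟩ := exists_isNatGauss_ne hxy
    exact ⟨g, ⟨_, ⟨g, (hA g).2 (Algebra.subset_adjoin hg), rfl⟩, rfl⟩, hne⟩
  · intro g hg
    rw [hA, ← Subalgebra.mem_toSubmodule, Algebra.adjoin_eq_span] at hg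
    induction hg using Submodule.span_induction with
    | mem g hg =>
      have : g = 1 ∨ IsNatGauss g := by
        induction hg using Submonoid.closure_induction with
        | mem g hg => exact Or.inr hg
        | one => exact Or.inl rfl
        | mul g h _ _ ihg ihh =>
          rcases ihg with rfl | ihg
          · simpa using ihh
          · rcases ihh with rfl | ihh
            · simpa using Or.inr ihg
            · exact Or.inr (ihg.mul ihh)
      rcases this with rfl | hg
      · simp
      · exact h g hg
    | zero => simp
    | add g k _ _ ihg ihk =>
      simp only [BoundedContinuousFunction.add_apply]
      rw [integral_add (g.integrable μ) (k.integrable μ),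
        integral_add (g.integrable ν) (k.integrable ν), ihg, ihk]
    | smul c g _ ihg =>
      simp only [BoundedContinuousFunction.smul_apply, integral_smul, ihg]

/-- A probability measure on phase space that pairs with Gaussians as a local equilibrium does is
the product of its position marginal and the Maxwellian. -/
lemma eq_prod_maxwellian {m : ℝ} (hm : 0 < m) {ν : Measure (Phase d)} [IsProbabilityMeasure ν]
    (h : ∀ (k l : ℕ) (b a : Fin d → ℕ), 0 < k → 0 < l →
      ∫ x, gaussExp k (1 / (2 * (1 / (2 * l)))) (fun i => (b i : ℝ)) (fun i => (a i : ℝ)) x ∂ν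
        = mehlerConst m (1 / (2 * l)) (fun i => (a i : ℝ)) 0
          * ∫ x, gaussExp k 0 (fun i => (b i : ℝ)) 0 x ∂ν) :
    ν = (ν.map Prod.fst).prod (maxwellian d m) := by
  have := isProbabilityMeasure_maxwellian (d := d) hm
  have : IsProbabilityMeasure (ν.map Prod.fst) :=
    Measure.isProbabilityMeasure_map measurable_fst.aemeasurable
  refine measure_ext_of_integral_isNatGauss fun g ⟨k, l, b, a, hk, hl, hg⟩ => ?_
  have hl' : (0 : ℝ) < l := by exact_mod_cast hl
  have hl2 : 1 / (2 * (1 / (2 * (l : ℝ)))) = l := by field_simp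
  have h1 := h k l b a hk hl
  rw [hl2] at h1
  simp only [hg, h1]
  rw [← integral_exp_maxwellian hm (by positivity), hl2]
  have h2 : ∀ x : Phase d, gaussExp k l (fun i => (b i : ℝ)) (fun i => (a i : ℝ)) x
      = Real.exp (∑ i, (b i * x.1 i - k * x.1 i ^ 2))
        * Real.exp (∑ i, (a i * x.2 i - l * x.2 i ^ 2)) := fun x => by
    rw [← Real.exp_add, gaussExp]
  simp_rw [h2]
  rw [integral_prod_mul (fun q : Fin d → ℝ => Real.exp (∑ i, (b i * q i - k * q i ^ 2)))
      (fun p : Fin d → ℝ => Real.exp (∑ i, (a i * p i - l * p i ^ 2))),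
    integral_map measurable_fst.aemeasurable
      (Continuous.aestronglyMeasurable (by fun_prop)), mul_comm]
  simp [gaussExp]

end Uniqueness

section Equilibrium

variable {d : ℕ} {m τ β r : ℝ}

lemma isTestFn_truncSmall_mehlerGauss (hm : 0 < m) (hτ : 0 < τ) (hβ : 0 < β)
    (hr : r ∈ Ioo (0 : ℝ) 1) (b a : Fin d → ℝ) (k : ℕ) :
    IsTestFn fun x => truncSmall k (mehlerGauss m τ β b a r x) := by
  have hD : 0 < mehlerDen m τ r := hτ.trans_le (le_mehlerDen hm (Ioo_subset_Icc_self hr))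
  have hr0 : 0 < r := hr.1
  exact isTestFn_truncSmall_comp (contDiff_gaussExp _ _ _ _)
    (tendsto_gaussExp_cocompact hβ (by positivity) _ _) k

lemma integral_ouP_mehlerGauss_eq_zero_of_truncSmall (hm : 0 < m) (hτ : 0 < τ) (hβ : 0 < β)
    (hr : r ∈ Ioo (0 : ℝ) 1) (b a : Fin d → ℝ) (ν : Measure (Phase d)) [IsProbabilityMeasure ν]
    (h : ∀ k, ∫ x, ouP m (fun x => truncSmall k (mehlerGauss m τ β b a r x)) x ∂ν = 0) :
    ∫ x, ouP m (mehlerGauss m τ β b a r) x ∂ν = 0 := by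
  obtain ⟨M, hM⟩ := exists_bound_mehlerGauss hm hτ hβ hr.1 b a
  have hM := hM r ⟨le_rfl, hr.2.le⟩
  exact integral_ouP_eq_zero_of_truncSmall (contDiff_gaussExp _ _ _ _)
    (gaussExp_pos _ _ _ _) (fun x => (hM x).1) (fun x => (hM x).2) ν
    (fun k => ((isTestFn_truncSmall_mehlerGauss hm hτ hβ hr b a k).ouP_bounded m).1.measurable) h

lemma ae_forall_integral_ouP_mehlerGauss_eq_zero {μ : Measure ℝ}
    {ρ : ℝ → ProbabilityMeasure (Phase d)} (hm : 0 < m)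
    (h : ∀ φ : Phase d → ℝ, IsTestFn φ →
      ∀ᵐ t ∂μ, ∫ x, ouP m φ x ∂(ρ t : Measure (Phase d)) = 0) :
    ∀ᵐ t ∂μ, ∀ (k l : ℕ) (b a : Fin d → ℕ) (r : ℚ), 0 < k → 0 < l → (r : ℝ) ∈ Ioo (0 : ℝ) 1 →
      ∫ x, ouP m (mehlerGauss m (1 / (2 * l)) k (fun i => (b i : ℝ)) (fun i => (a i : ℝ)) r) x
        ∂(ρ t : Measure (Phase d)) = 0 := by
  simp only [ae_all_iff]
  intro k l b a r hk hl hr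
  have hk' : (0 : ℝ) < k := by exact_mod_cast hk
  have hl' : (0 : ℝ) < 1 / (2 * l) := by
    have : (0 : ℝ) < l := by exact_mod_cast hl
    positivity
  have := ae_all_iff.2 fun j => h _ (isTestFn_truncSmall_mehlerGauss hm hl' hk' hr
    (fun i => (b i : ℝ)) (fun i => (a i : ℝ)) j)
  filter_upwards [this] with t ht
  exact integral_ouP_mehlerGauss_eq_zero_of_truncSmall hm hl' hk' hr _ _ _ ht

end Equilibrium

/-- Lemma 2.5, local equilibrium: under the a priori bound, if
`ρ^{γ_n} → ρ` narrowly in `M([0,T]×ℝ^{2d})` and `ξ^{γ_n}_#ρ^{γ_n} → ξ_#ρ` in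
`C([0,T];P(ℝ^d))`, then there is a narrowly continuous curve `σ` with
`ρ_t = Z⁻¹e^{−p²/2m} σ_t(dq) dp` for a.e. `t`, and `ξ^{γ_n}_#ρ^{γ_n} → σ` uniformly
in time and narrowly on `P(ℝ^d)`. -/
theorem stmt5 {d : ℕ} {m : ℝ} (V ψ : (Fin d → ℝ) → ℝ)
    (hyp : PotentialHyp d m V ψ)
    (T : ℝ) (hT : 0 < T)
    (γs : ℕ → ℝ) (hγpos : ∀ n, 0 < γs n) (hγ : Tendsto γs atTop atTop)
    (ρseq : ℕ → ℝ → ProbabilityMeasure (Phase d))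
    (hρcont : ∀ n, ContinuousOn (ρseq n) (Icc 0 T))
    (C : ℝ≥0∞) (hC : C ≠ ⊤)
    (hbound : ∀ n, RateI m (γs n) T V ψ (ρseq n)
      + FreeEnergy m V ψ (ρseq n 0 : Measure (Phase d)) ≤ C)
    (ρ : ℝ → ProbabilityMeasure (Phase d))
    (hconv : ∀ F : BoundedContinuousFunction (ℝ × Phase d) ℝ,
      Tendsto
        (fun n => ∫ t in Icc (0 : ℝ) T,
          (∫ x, F (t, x) ∂(ρseq n t : Measure (Phase d))))
        atTop
        (𝓝 (∫ t in Icc (0 : ℝ) T, (∫ x, F (t, x) ∂(ρ t : Measure (Phase d))))))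
    (hconvξ : ∀ g : BoundedContinuousFunction (Fin d → ℝ) ℝ,
      TendstoUniformlyOn
        (fun n t => ∫ x, g (xiGamma (γs n) x) ∂(ρseq n t : Measure (Phase d)))
        (fun t => ∫ x, g x.1 ∂(ρ t : Measure (Phase d)))
        atTop (Icc 0 T)) :
    ∃ σ : ℝ → ProbabilityMeasure (Fin d → ℝ),
      ContinuousOn σ (Icc 0 T) ∧
      (∀ᵐ t ∂(volume.restrict (Icc (0 : ℝ) T)),
        (ρ t : Measure (Phase d)) = (σ t : Measure (Fin d → ℝ)).prod (maxwellian d m)) ∧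
      (∀ g : BoundedContinuousFunction (Fin d → ℝ) ℝ,
        TendstoUniformlyOn
          (fun n t => ∫ x, g (xiGamma (γs n) x) ∂(ρseq n t : Measure (Phase d)))
          (fun t => ∫ q, g q ∂(σ t : Measure (Fin d → ℝ)))
          atTop (Icc 0 T)) := by
  have hm := hyp.hm
  let σ : ℝ → ProbabilityMeasure (Fin d → ℝ) := fun t => (ρ t).map measurable_fst.aemeasurable
  have hσ : ∀ (g : BoundedContinuousFunction (Fin d → ℝ) ℝ) t,
      ∫ q, g q ∂(σ t : Measure (Fin d → ℝ)) = ∫ x, g x.1 ∂(ρ t : Measure (Phase d)) :=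
    fun g t => by
      rw [ProbabilityMeasure.toMeasure_map]
      exact integral_map measurable_fst.aemeasurable g.continuous.aestronglyMeasurable
  refine ⟨σ, fun t ht => ?_, ?_, fun g => ?_⟩
  · rw [ContinuousWithinAt, ProbabilityMeasure.tendsto_iff_forall_integral_tendsto]
    intro g
    simp only [hσ]
    have hξ : ∀ n, Continuous (xiGamma (d := d) (γs n)) := fun n => by
      unfold xiGamma
      fun_prop
    exact (hconvξ g).continuousOn (Eventually.frequently (Eventually.of_forall fun n =>
      continuousOn_integral_of_bound (hρcont n) (g.continuous.comp (hξ n))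
        fun x => g.norm_coe_le_norm _)) t ht
  · have hrate : ∀ n, RateI m (γs n) T V ψ (ρseq n) ≤ C := fun n => le_self_add.trans (hbound n)
    have hae := ae_forall_integral_ouP_mehlerGauss_eq_zero hm fun φ hφ =>
      ae_integral_ouP_eq_zero hyp hT hγpos hγ hρcont hC hrate hconv hφ
    filter_upwards [hae] with t ht
    rw [ProbabilityMeasure.toMeasure_map]
    refine eq_prod_maxwellian hm fun k l b a hk hl => ?_
    have hk' : (0 : ℝ) < k := by exact_mod_cast hk
    have hl' : (0 : ℝ) < l := by exact_mod_cast hl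
    exact integral_gaussExp_eq hm (by positivity) hk' _ _ _ fun r hr => ht k l b a r hk hl hr
  · simp only [hσ]
    exact hconvξ g

end
end
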